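/- arXiv:0705.3806 — 5 statements merged into one kernel-verified Lean document; each statement's English description precedes it below -/
import Mathlib

section
/- For every real η > 2 ln 2 there exist constants C > 0 and R > 0 such that the following holds: for all integers n, k, m ≥ 1 with k ≤ (2 ln 2)·m and n ≥ R·k, every function f assigning to each x ∈ {0,1}^n a 2^m-dimensional density matrix f(x), and every family of POVMs {M_{S,z}}_{z ∈ {0,1}^k} indexed by the k-element subsets S of [n] (i.e., each M_{S,z} is a positive semidefinite 2^m × 2^m complex matrix and ∑_{z ∈ {0,1}^k} M_{S,z} = I for every S), the average success probability satisfies E_{x,S}[ Tr(M_{S,x_S} · f(x)) ] ≤ C · (1/2 + (1/2)·√(η·m/n))^k, where the expectation is over a uniformly random x ∈ {0,1}^n and a uniformly random k-element subset S of [n], and x_S ∈ {0,1}^k denotes the substring of x indexed by S (in increasing order of indices). -/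
open scoped ComplexOrder

/-- The substring of `x ∈ {0,1}^n` indexed by a `k`-element subset `S ⊆ [n]`,
taken in increasing order of indices. (Junk value if `S.card ≠ k`.) -/
noncomputable def substringOf {n k : ℕ} (x : Fin n → Bool) (S : Finset (Fin n)) :
    Fin k → Bool :=
  fun j => if h : S.card = k then x ((S.orderIsoOfFin h j : Fin n)) else false

section Walsh

variable {ι : Type*}

/-- The sign `(-1)^b` of a bit. -/
def bitSign (b : Bool) : ℝ := if b then -1 else 1

lemma bitSign_mul_self (b : Bool) : bitSign b * bitSign b = 1 := by
  cases b <;> simp [bitSign]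

lemma bitSign_not (b : Bool) : bitSign (!b) = -bitSign b := by
  cases b <;> simp [bitSign]

/-- The Walsh character `x ↦ (-1)^{∑_{i ∈ T} x_i}`. -/
def walsh (T : Finset ι) (x : ι → Bool) : ℝ := ∏ i ∈ T, bitSign (x i)

@[simp] lemma walsh_empty (x : ι → Bool) : walsh ∅ x = 1 := by simp [walsh]

lemma walsh_sq (T : Finset ι) (x : ι → Bool) : walsh T x * walsh T x = 1 := by
  simp [walsh, ← Finset.prod_mul_distrib, bitSign_mul_self]

lemma abs_walsh (T : Finset ι) (x : ι → Bool) : |walsh T x| = 1 := by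
  have h := walsh_sq T x
  rw [← abs_mul_abs_self] at h
  nlinarith [abs_nonneg (walsh T x)]

variable [DecidableEq ι]

lemma walsh_insert {T : Finset ι} {i : ι} (hi : i ∉ T) (x : ι → Bool) :
    walsh (insert i T) x = bitSign (x i) * walsh T x := by
  simp [walsh, Finset.prod_insert hi]

lemma walsh_mul [Fintype ι] (U T : Finset ι) (x : ι → Bool) :
    walsh U x * walsh T x = walsh (symmDiff U T) x := by
  have h : ∀ V : Finset ι, walsh V x = ∏ i, if i ∈ V then bitSign (x i) else 1 := by
    intro V
    simp [walsh, Finset.prod_ite_mem]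
  rw [h, h, h, ← Finset.prod_mul_distrib]
  refine Finset.prod_congr rfl fun i _ => ?_
  have := bitSign_mul_self (x i)
  by_cases h₁ : i ∈ U <;> by_cases h₂ : i ∈ T <;> simp [Finset.mem_symmDiff, h₁, h₂, this]

/-- Flipping the `i`-th bit of a string. -/
def flipBit (i : ι) (x : ι → Bool) : ι → Bool := Function.update x i (!x i)

lemma flipBit_involutive (i : ι) : Function.Involutive (flipBit i) := by
  intro x
  simp [flipBit]

lemma walsh_flipBit_of_notMem {T : Finset ι} {i : ι} (hi : i ∉ T) (x : ι → Bool) :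
    walsh T (flipBit i x) = walsh T x := by
  refine Finset.prod_congr rfl fun j hj => ?_
  have : j ≠ i := fun h => hi (h ▸ hj)
  simp [flipBit, this]

lemma walsh_flipBit_of_mem {T : Finset ι} {i : ι} (hi : i ∈ T) (x : ι → Bool) :
    walsh T (flipBit i x) = -walsh T x := by
  rw [← Finset.insert_erase hi, walsh_insert (Finset.notMem_erase i T),
    walsh_insert (Finset.notMem_erase i T), walsh_flipBit_of_notMem (Finset.notMem_erase i T)]
  simp [flipBit, bitSign_not]

variable [Fintype ι]

lemma sum_flipBit {E : Type*} [AddCommMonoid E] (i : ι) (G : (ι → Bool) → E) :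
    ∑ x, G (flipBit i x) = ∑ x, G x :=
  Equiv.sum_comp (flipBit_involutive i).toPerm G

lemma sum_walsh_nonneg (T : Finset ι) : 0 ≤ ∑ x, walsh T x := by
  rcases T.eq_empty_or_nonempty with rfl | ⟨i, hi⟩
  · simp
  · have h := sum_flipBit i (walsh T)
    simp_rw [walsh_flipBit_of_mem hi, Finset.sum_neg_distrib] at h
    linarith

/-- Moments of a Walsh polynomial with coefficients in a normed algebra are dominated by the
moments of the scalar polynomial obtained by replacing every coefficient by a norm bound. -/
lemma norm_sum_walsh_smul_pow_le {A : Type*} [NormedRing A] [NormOneClass A] [NormedAlgebra ℂ A]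
    (𝒯 : Finset (Finset ι)) (B : Finset ι → A) (w : ℝ) (hB : ∀ T ∈ 𝒯, ‖B T‖ ≤ w)
    (a : ℕ) (U : Finset ι) :
    ‖∑ x, (walsh U x : ℂ) • (∑ T ∈ 𝒯, (walsh T x : ℂ) • B T) ^ a‖ ≤
      ∑ x, walsh U x * (∑ T ∈ 𝒯, w * walsh T x) ^ a := by
  induction a generalizing U with
  | zero =>
    simp only [pow_zero, mul_one]
    rw [← Finset.sum_smul, norm_smul, norm_one, mul_one, ← Complex.ofReal_sum,
      Complex.norm_real, Real.norm_eq_abs, abs_of_nonneg (sum_walsh_nonneg U)]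
  | succ a ih =>
    have h₁ : ∑ x, (walsh U x : ℂ) • (∑ T ∈ 𝒯, (walsh T x : ℂ) • B T) ^ (a + 1) =
        ∑ T ∈ 𝒯, (∑ x, (walsh (symmDiff U T) x : ℂ) •
          (∑ T ∈ 𝒯, (walsh T x : ℂ) • B T) ^ a) * B T := by
      simp_rw [Finset.sum_mul]
      rw [Finset.sum_comm]
      refine Finset.sum_congr rfl fun x _ => ?_
      rw [pow_succ, Finset.mul_sum, Finset.smul_sum]
      refine Finset.sum_congr rfl fun T _ => ?_
      rw [← walsh_mul, mul_smul_comm, smul_mul_assoc, smul_smul, Complex.ofReal_mul]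
    have h₂ : ∑ x, walsh U x * (∑ T ∈ 𝒯, w * walsh T x) ^ (a + 1) =
        ∑ T ∈ 𝒯, (∑ x, walsh (symmDiff U T) x * (∑ T ∈ 𝒯, w * walsh T x) ^ a) * w := by
      simp_rw [Finset.sum_mul]
      rw [Finset.sum_comm]
      refine Finset.sum_congr rfl fun x _ => ?_
      rw [pow_succ, Finset.mul_sum, Finset.mul_sum]
      refine Finset.sum_congr rfl fun T _ => ?_
      rw [← walsh_mul]
      ring
    rw [h₁, h₂]
    refine (norm_sum_le _ _).trans (Finset.sum_le_sum fun T hT => ?_)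
    exact (norm_mul_le _ _).trans
      (mul_le_mul (ih _) (hB T hT) (norm_nonneg _) ((norm_nonneg _).trans (ih _)))

end Walsh

section TwoPoint

lemma sum_range_two_mul_add_one (g : ℕ → ℝ) (r : ℕ) :
    ∑ i ∈ Finset.range (2 * r + 1), g i =
      ∑ i ∈ Finset.range (r + 1), g (2 * i) + ∑ i ∈ Finset.range r, g (2 * i + 1) := by
  induction r with
  | zero => simp
  | succ r ih =>
    rw [show 2 * (r + 1) + 1 = 2 * r + 1 + 1 + 1 by ring, Finset.sum_range_succ,
      Finset.sum_range_succ, ih, Finset.sum_range_succ _ (r + 1), Finset.sum_range_succ _ r,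
      Finset.sum_range_succ _ r]
    rw [show 2 * r + 1 + 1 = 2 * (r + 1) by ring]
    ring

lemma choose_two_mul_le (r i : ℕ) (hr : 1 ≤ r) (hi : i ≤ r) :
    ((2 * r).choose (2 * i) : ℝ) ≤ (2 * r - 1) ^ i * r.choose i := by
  induction i with
  | zero => simp
  | succ i ih =>
    have ih := ih (by omega)
    have h₁ := Nat.choose_succ_right_eq (2 * r) (2 * i)
    have h₂ := Nat.choose_succ_right_eq (2 * r) (2 * i + 1)
    have h₃ := Nat.choose_succ_right_eq r i
    obtain ⟨s, rfl⟩ : ∃ s, r = i + 1 + s := ⟨r - (i + 1), by omega⟩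
    rw [show 2 * (i + 1 + s) - 2 * i = 2 * s + 2 by omega] at h₁
    rw [show 2 * (i + 1 + s) - (2 * i + 1) = 2 * s + 1 by omega] at h₂
    rw [show i + 1 + s - i = s + 1 by omega] at h₃
    rw [show 2 * (i + 1) = 2 * i + 1 + 1 by ring]
    set a : ℕ := (2 * (i + 1 + s)).choose (2 * i)
    set b : ℕ := (2 * (i + 1 + s)).choose (2 * i + 1)
    set c : ℕ := (2 * (i + 1 + s)).choose (2 * i + 1 + 1)
    set d : ℕ := (i + 1 + s).choose i
    set e : ℕ := (i + 1 + s).choose (i + 1)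
    have h₁ : (b : ℝ) * (2 * i + 1) = a * (2 * s + 2) := by exact_mod_cast h₁
    have h₂ : (c : ℝ) * (2 * i + 1 + 1) = b * (2 * s + 1) := by exact_mod_cast h₂
    have h₃ : (e : ℝ) * (i + 1) = d * (s + 1) := by exact_mod_cast h₃
    have hc : (c : ℝ) = a * ((s + 1) * (2 * s + 1) / ((i + 1) * (2 * i + 1))) := by
      field_simp
      linear_combination (2 * (i : ℝ) + 1) / 2 * h₂ + (2 * (s : ℝ) + 1) / 2 * h₁
    have he : (e : ℝ) = d * ((s + 1) / (i + 1)) := by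
      field_simp
      exact h₃
    push_cast at ih ⊢
    rw [hc, he, pow_succ]
    have hq : (0 : ℝ) ≤ 2 * (i + 1 + s) - 1 := by
      have : (0 : ℝ) ≤ i := by positivity
      have : (0 : ℝ) ≤ s := by positivity
      linarith
    calc (a : ℝ) * ((s + 1) * (2 * s + 1) / ((i + 1) * (2 * i + 1)))
        ≤ ((2 * (i + 1 + s) - 1) ^ i * d) * ((s + 1) * (2 * s + 1) / ((i + 1) * (2 * i + 1))) := by
          gcongr
      _ = ((2 * (i + 1 + s) - 1) ^ i * d) * ((s + 1) / (i + 1)) *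
            ((2 * s + 1) / (2 * i + 1)) := by
          field_simp
      _ ≤ ((2 * (i + 1 + s) - 1) ^ i * d) * ((s + 1) / (i + 1)) * (2 * (i + 1 + s) - 1) := by
          refine mul_le_mul_of_nonneg_left ?_ (by positivity)
          rw [div_le_iff₀ (by positivity)]
          have h₁ : (0 : ℝ) ≤ i := by positivity
          have h₂ : (0 : ℝ) ≤ s := by positivity
          nlinarith [mul_nonneg h₁ h₂, mul_nonneg h₁ h₁]
      _ = _ := by ring

/-- The two-point inequality behind hypercontractivity for even exponents. -/
lemma add_pow_add_sub_pow_le (a b : ℝ) {r : ℕ} (hr : 1 ≤ r) :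
    (a + b) ^ (2 * r) + (a - b) ^ (2 * r) ≤ 2 * (a ^ 2 + (2 * r - 1) * b ^ 2) ^ r := by
  have h : (a + b) ^ (2 * r) + (a - b) ^ (2 * r) =
      2 * ∑ i ∈ Finset.range (r + 1), b ^ (2 * i) * a ^ (2 * r - 2 * i) *
        (2 * r).choose (2 * i) := by
    rw [sub_eq_neg_add, add_comm a b, add_pow, add_pow, ← Finset.sum_add_distrib,
      sum_range_two_mul_add_one, Finset.mul_sum]
    rw [Finset.sum_eq_zero (s := Finset.range r), add_zero]
    · refine Finset.sum_congr rfl fun i _ => ?_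
      rw [Even.neg_pow (even_two_mul i)]
      ring
    · intro i _
      rw [Odd.neg_pow (odd_two_mul_add_one i)]
      ring
  rw [h, add_comm (a ^ 2), add_pow]
  refine mul_le_mul_of_nonneg_left (Finset.sum_le_sum fun i hi => ?_) zero_le_two
  have hi : i ≤ r := by simpa [Nat.lt_succ_iff] using hi
  calc b ^ (2 * i) * a ^ (2 * r - 2 * i) * (2 * r).choose (2 * i)
      ≤ b ^ (2 * i) * a ^ (2 * r - 2 * i) * ((2 * r - 1) ^ i * r.choose i) := by
        refine mul_le_mul_of_nonneg_left (choose_two_mul_le r i hr hi) ?_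
        rw [← Nat.mul_sub, pow_mul, pow_mul]
        positivity
    _ = _ := by
        rw [← Nat.mul_sub, pow_mul, pow_mul, mul_pow]
        ring

end TwoPoint

lemma sum_add_pow_le_of_sum_pow_le {α : Type*} (s : Finset α) (u v : α → ℝ) {N A B : ℝ} {r : ℕ}
    (hr : 1 ≤ r) (hN : 0 ≤ N) (hA : 0 ≤ A) (hB : 0 ≤ B)
    (hu : ∀ i ∈ s, 0 ≤ u i) (hv : ∀ i ∈ s, 0 ≤ v i)
    (hus : ∑ i ∈ s, u i ^ r ≤ N * A ^ r) (hvs : ∑ i ∈ s, v i ^ r ≤ N * B ^ r) :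
    ∑ i ∈ s, (u i + v i) ^ r ≤ N * (A + B) ^ r := by
  have hr0 : (r : ℝ) ≠ 0 := by positivity
  have h := Real.Lp_add_le_of_nonneg s (p := r) (by exact_mod_cast hr) hu hv
  simp_rw [Real.rpow_natCast] at h
  have key : ∀ {X Y : ℝ}, 0 ≤ X → 0 ≤ Y → X ≤ N * Y ^ r →
      X ^ (1 / (r : ℝ)) ≤ N ^ (1 / (r : ℝ)) * Y := by
    intro X Y hX hY hXY
    refine (Real.rpow_le_rpow hX hXY (by positivity)).trans_eq ?_
    rw [Real.mul_rpow hN (by positivity), ← Real.rpow_natCast, ← Real.rpow_mul hY,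
      mul_one_div_cancel hr0, Real.rpow_one]
  have h' : (∑ i ∈ s, (u i + v i) ^ r) ^ (1 / (r : ℝ)) ≤ N ^ (1 / (r : ℝ)) * (A + B) := by
    rw [mul_add]
    exact h.trans (add_le_add (key (Finset.sum_nonneg fun i hi => pow_nonneg (hu i hi) r) hA hus)
      (key (Finset.sum_nonneg fun i hi => pow_nonneg (hv i hi) r) hB hvs))
  have hS : 0 ≤ ∑ i ∈ s, (u i + v i) ^ r :=
    Finset.sum_nonneg fun i hi => pow_nonneg (add_nonneg (hu i hi) (hv i hi)) r
  have h'' := pow_le_pow_left₀ (by positivity) h' r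
  rwa [mul_pow, ← Real.rpow_natCast, ← Real.rpow_natCast (N ^ _), ← Real.rpow_mul hS,
    ← Real.rpow_mul hN, one_div_mul_cancel hr0, Real.rpow_one, Real.rpow_one] at h''

/-- Even moments of elementary symmetric polynomials in independent uniform signs. -/
lemma sum_sum_walsh_pow_le {ι : Type*} [DecidableEq ι] [Fintype ι] {r : ℕ} (hr : 1 ≤ r)
    (V : Finset ι) (j : ℕ) :
    ∑ x, (∑ T ∈ V.powersetCard j, walsh T x) ^ (2 * r) ≤
      2 ^ Fintype.card ι * ((2 * r - 1 : ℝ) ^ j * V.card.choose j) ^ r := by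
  have hq : (0 : ℝ) ≤ 2 * r - 1 := by
    have : (1 : ℝ) ≤ r := by exact_mod_cast hr
    linarith
  induction V using Finset.induction_on generalizing j with
  | empty =>
    cases j with
    | zero => simp
    | succ j => simp [Finset.powersetCard_eq_empty.2 (show (∅ : Finset ι).card < j + 1 by simp),
        show r ≠ 0 by omega]
  | insert v V hv ih =>
    cases j with
    | zero => simp
    | succ j =>
      set a : (ι → Bool) → ℝ := fun x => ∑ T ∈ V.powersetCard (j + 1), walsh T x with ha
      set b : (ι → Bool) → ℝ := fun x => ∑ T ∈ V.powersetCard j, walsh T x with hb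
      have hvT : ∀ {i : ℕ} {T : Finset ι}, T ∈ V.powersetCard i → v ∉ T := fun hT h =>
        hv ((Finset.mem_powersetCard.1 hT).1 h)
      have hsplit : ∀ x, ∑ T ∈ (insert v V).powersetCard (j + 1), walsh T x =
          a x + bitSign (x v) * b x := by
        intro x
        rw [Finset.powersetCard_succ_insert hv, Finset.sum_union, Finset.sum_image, hb,
          Finset.mul_sum]
        · congr 1
          exact Finset.sum_congr rfl fun T hT => walsh_insert (hvT hT) x
        · intro T hT T' hT' h
          rw [← Finset.erase_insert (hvT hT), ← Finset.erase_insert (hvT hT'), h]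
        · rw [Finset.disjoint_left]
          intro T hT hT'
          obtain ⟨T', -, rfl⟩ := Finset.mem_image.1 hT'
          exact hvT hT (Finset.mem_insert_self v T')
      have hflip : ∀ x, a (flipBit v x) + bitSign (flipBit v x v) * b (flipBit v x) =
          a x - bitSign (x v) * b x := by
        intro x
        have h₁ : a (flipBit v x) = a x :=
          Finset.sum_congr rfl fun T hT => walsh_flipBit_of_notMem (hvT hT) x
        have h₂ : b (flipBit v x) = b x :=
          Finset.sum_congr rfl fun T hT => walsh_flipBit_of_notMem (hvT hT) x
        rw [h₁, h₂]
        simp [flipBit, bitSign_not, sub_eq_add_neg]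
      have htwo : 2 * ∑ x, (a x + bitSign (x v) * b x) ^ (2 * r) ≤
          2 * ∑ x, (a x ^ 2 + (2 * r - 1) * b x ^ 2) ^ r := by
        have h := sum_flipBit v fun x => (a x + bitSign (x v) * b x) ^ (2 * r)
        simp only [hflip] at h
        rw [two_mul]
        nth_rw 2 [← h]
        rw [← Finset.sum_add_distrib, Finset.mul_sum]
        refine Finset.sum_le_sum fun x _ => ?_
        refine (add_pow_add_sub_pow_le _ _ hr).trans_eq ?_
        rw [mul_pow, pow_two (bitSign _), bitSign_mul_self, one_mul]
      simp_rw [hsplit]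
      refine (le_of_mul_le_mul_left htwo two_pos).trans ?_
      rw [Finset.card_insert_of_notMem hv, Nat.choose_succ_succ, Nat.cast_add, mul_add,
        add_comm (_ * ((V.card.choose j : ℕ) : ℝ))]
      refine sum_add_pow_le_of_sum_pow_le _ _ _ hr (by positivity) (by positivity) (by positivity)
        (fun x _ => by positivity) (fun x _ => by positivity) ?_ ?_
      · simpa only [← pow_mul] using ih (j + 1)
      · have := mul_le_mul_of_nonneg_left (ih j) (pow_nonneg hq r)
        calc ∑ x, ((2 * r - 1) * b x ^ 2) ^ r = (2 * r - 1) ^ r * ∑ x, b x ^ (2 * r) := by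
              rw [Finset.mul_sum]
              refine Finset.sum_congr rfl fun x _ => ?_
              rw [mul_pow, ← pow_mul]
          _ ≤ _ := this
          _ = _ := by
              simp only [mul_pow, pow_succ]
              ring
section Matrices

open Matrix

lemma isHermitian_sum_ofReal_smul {d Z : Type*} [Fintype Z] {M : Z → Matrix d d ℂ}
    (hM : ∀ z, (M z).IsHermitian) (c : Z → ℝ) : (∑ z, (c z : ℂ) • M z).IsHermitian := by
  unfold Matrix.IsHermitian
  rw [Matrix.conjTranspose_sum]
  refine Finset.sum_congr rfl fun z _ => ?_
  rw [Matrix.conjTranspose_smul, (hM z).eq]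
  simp

variable {d : Type*} [Fintype d] [DecidableEq d]

/-- Jensen's inequality for the spectral distribution of a Hermitian matrix in a given state. -/
lemma re_trace_mul_pow_le {P ρ : Matrix d d ℂ} (hP : P.IsHermitian) (hρ : ρ.PosSemidef)
    (hρ1 : ρ.trace = 1) (r : ℕ) :
    (P * ρ).trace.re ^ (2 * r) ≤ (P ^ (2 * r)).trace.re := by
  set U : Matrix d d ℂ := (hP.eigenvectorUnitary : Matrix d d ℂ)
  set g : Matrix d d ℂ := star U * ρ * U with hg
  have hUU : U * star U = 1 := Unitary.coe_mul_star_self hP.eigenvectorUnitary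
  have hUU' : star U * U = 1 := Unitary.coe_star_mul_self hP.eigenvectorUnitary
  have hgpos : g.PosSemidef := hρ.conjTranspose_mul_mul_same U
  have hg0 : ∀ i, 0 ≤ (g i i).re := fun i => (Complex.le_def.1 hgpos.diag_nonneg).1
  have hgtr : g.trace = 1 := by
    rw [hg, Matrix.trace_mul_comm, ← mul_assoc, hUU, one_mul, hρ1]
  have hg1 : ∑ i, (g i i).re = 1 := by
    have := congrArg Complex.re hgtr
    simpa [Matrix.trace, Matrix.diag] using this
  have hspec := hP.spectral_theorem
  have h₁ : (P * ρ).trace.re = ∑ i, (g i i).re * hP.eigenvalues i := by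
    conv_lhs => rw [hspec, Unitary.conjStarAlgAut_apply]
    rw [mul_assoc, mul_assoc, Matrix.trace_mul_comm, mul_assoc]
    change (Matrix.trace (_ * g)).re = _
    simp [Matrix.trace, Matrix.diagonal_mul, mul_comm]
  have h₂ : (P ^ (2 * r)).trace.re = ∑ i, hP.eigenvalues i ^ (2 * r) := by
    conv_lhs => rw [hspec, ← map_pow, Unitary.conjStarAlgAut_apply]
    rw [Matrix.trace_mul_comm, ← mul_assoc]
    change (Matrix.trace (star U * U * _)).re = _
    rw [hUU', one_mul, Matrix.diagonal_pow]
    simp [Matrix.trace, ← Complex.ofReal_pow]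
  rw [h₁, h₂]
  refine (Real.pow_arith_mean_le_arith_mean_pow_of_even Finset.univ _ _ (fun i _ => hg0 i) hg1
    (even_two_mul r)).trans (Finset.sum_le_sum fun i _ => ?_)
  have hle : (g i i).re ≤ 1 := hg1 ▸ Finset.single_le_sum (fun j _ => hg0 j) (Finset.mem_univ i)
  exact mul_le_of_le_one_left (by rw [pow_mul]; positivity) hle

open scoped Matrix.Norms.L2Operator MatrixOrder

lemma norm_apply_le_l2_opNorm (A : Matrix d d ℂ) (i j : d) : ‖A i j‖ ≤ ‖A‖ := by
  have h := Matrix.l2_opNorm_mulVec A (EuclideanSpace.single j 1)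
  rw [PiLp.norm_single, norm_one, mul_one] at h
  refine le_trans ?_ h
  refine le_trans (le_of_eq ?_) (PiLp.norm_apply_le _ i)
  simp

lemma norm_trace_le_card_mul (A : Matrix d d ℂ) : ‖A.trace‖ ≤ Fintype.card d * ‖A‖ := by
  refine (norm_sum_le _ _).trans ?_
  refine (Finset.sum_le_sum fun i _ => norm_apply_le_l2_opNorm A i i).trans_eq ?_
  simp

/-- A combination of the effects of a POVM with coefficients in `[-1, 1]` is a contraction. -/
lemma norm_sum_smul_le_one {Z : Type*} [Fintype Z] {M : Z → Matrix d d ℂ}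
    (hM : ∀ z, (M z).PosSemidef) (hM1 : ∑ z, M z = 1) {c : Z → ℝ} (hc : ∀ z, |c z| ≤ 1) :
    ‖∑ z, (c z : ℂ) • M z‖ ≤ 1 := by
  have hAh := isHermitian_sum_ofReal_smul (fun z => (hM z).isHermitian) c
  set A := ∑ z, (c z : ℂ) • M z with hA
  have h₁ : 0 ≤ 1 - A := by
    rw [← hM1, hA, ← Finset.sum_sub_distrib]
    refine Finset.sum_nonneg fun z _ => ?_
    rw [Matrix.nonneg_iff_posSemidef,
      show M z - (c z : ℂ) • M z = ((1 - c z : ℝ) : ℂ) • M z by simp [sub_smul]]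
    exact (hM z).smul (by exact_mod_cast sub_nonneg.2 (abs_le.1 (hc z)).2)
  have h₂ : 0 ≤ 1 + A := by
    rw [← hM1, hA, ← Finset.sum_add_distrib]
    refine Finset.sum_nonneg fun z _ => ?_
    rw [Matrix.nonneg_iff_posSemidef,
      show M z + (c z : ℂ) • M z = ((1 + c z : ℝ) : ℂ) • M z by simp [add_smul]]
    exact (hM z).smul (by exact_mod_cast (by linarith [(abs_le.1 (hc z)).1] : 0 ≤ 1 + c z))
  have hcomm : Commute (1 - A) (1 + A) := by
    simp only [Commute, SemiconjBy]
    noncomm_ring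
  have h₃ := Commute.mul_nonneg h₁ h₂ hcomm
  have h₄ : star A * A ≤ 1 := by
    rw [← sub_nonneg, Matrix.star_eq_conjTranspose, hAh.eq]
    convert h₃ using 1
    noncomm_ring
  have h₅ := (CStarAlgebra.norm_le_one_iff_of_nonneg (star A * A) (star_mul_self_nonneg A)).2 h₄
  rw [CStarRing.norm_star_mul_self] at h₅
  nlinarith [norm_nonneg A]

end Matrices

lemma card_filter_superset_powersetCard {α : Type*} [Fintype α] [DecidableEq α] {T : Finset α}
    {k : ℕ} (hk : T.card ≤ k) :
    ((Finset.univ.powersetCard k).filter fun S => T ⊆ S).card =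
      (Fintype.card α - T.card).choose (k - T.card) := by
  rw [← Finset.card_compl, ← Finset.card_powersetCard]
  refine Finset.card_bij' (fun S _ => S \ T) (fun V _ => V ∪ T) ?_ ?_ ?_ ?_
  · intro S hS
    simp only [Finset.mem_filter, Finset.mem_powersetCard] at hS ⊢
    refine ⟨fun i hi => by simp_all, ?_⟩
    rw [Finset.card_sdiff_of_subset hS.2, hS.1.2]
  · intro V hV
    simp only [Finset.mem_filter, Finset.mem_powersetCard] at hV ⊢
    refine ⟨⟨Finset.subset_univ _, ?_⟩, Finset.subset_union_right⟩
    rw [Finset.card_union_of_disjoint, hV.2]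
    · omega
    · exact Finset.disjoint_left.2 fun i hi => by simpa using hV.1 hi
  · intro S hS
    simp only [Finset.mem_filter] at hS
    exact Finset.sdiff_union_of_subset hS.2
  · intro V hV
    simp only [Finset.mem_powersetCard] at hV
    rw [Finset.union_sdiff_right, Finset.sdiff_eq_self_of_disjoint]
    exact Finset.disjoint_left.2 fun i hi => by simpa using hV.1 hi

lemma factorial_le_mul_div_exp_pow {j : ℕ} (hj : 1 ≤ j) :
    (j.factorial : ℝ) ≤ Real.exp 1 * j * (j / Real.exp 1) ^ j := by
  induction j, hj using Nat.le_induction with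
  | base => simp
  | succ j hj ih =>
    have hj0 : (0 : ℝ) < j := by exact_mod_cast hj
    have hkey : Real.exp 1 * (j : ℝ) ^ (j + 1) ≤ ((j : ℝ) + 1) ^ (j + 1) := by
      have h₁ : (j : ℝ) / (j + 1) ≤ Real.exp (-(1 / (j + 1))) := by
        refine le_trans (le_of_eq ?_) (Real.add_one_le_exp _)
        field_simp
        ring
      have h₂ := pow_le_pow_left₀ (by positivity) h₁ (j + 1)
      rw [← Real.exp_nat_mul, div_pow, div_le_iff₀ (by positivity)] at h₂
      have h₃ : ((j + 1 : ℕ) : ℝ) * -(1 / ((j : ℝ) + 1)) = -1 := by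
        push_cast
        field_simp
      rw [h₃] at h₂
      calc Real.exp 1 * (j : ℝ) ^ (j + 1)
          ≤ Real.exp 1 * (Real.exp (-1) * ((j : ℝ) + 1) ^ (j + 1)) := by gcongr
        _ = _ := by rw [← mul_assoc, ← Real.exp_add]; simp
    rw [Nat.factorial_succ]
    push_cast
    calc ((j : ℝ) + 1) * j.factorial
        ≤ (j + 1) * (Real.exp 1 * j * (j / Real.exp 1) ^ j) := by gcongr
      _ = (j + 1) * (Real.exp 1 * (j : ℝ) ^ (j + 1)) / Real.exp 1 ^ j := by
          rw [div_pow, pow_succ (j : ℝ)]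
          ring
      _ ≤ (j + 1) * ((j : ℝ) + 1) ^ (j + 1) / Real.exp 1 ^ j := by gcongr
      _ = _ := by
          rw [div_pow, pow_succ (Real.exp 1)]
          field_simp

lemma nat_mul_pow_le {y : ℝ} (hy0 : 0 ≤ y) (hy1 : y < 1) (j : ℕ) :
    j * y ^ j ≤ (1 - y)⁻¹ := by
  have h₁ : (j : ℝ) * y ^ j ≤ ∑ i ∈ Finset.range j, y ^ i := by
    rw [← nsmul_eq_mul]
    have := Finset.card_nsmul_le_sum (Finset.range j) (fun i => y ^ i) (y ^ j) fun i hi =>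
      pow_le_pow_of_le_one hy0 hy1.le (Finset.mem_range.1 hi).le
    simpa using this
  refine h₁.trans ?_
  rw [← tsum_geometric_of_lt_one hy0 hy1]
  exact (summable_geometric_of_lt_one hy0 hy1).sum_le_tsum _ fun i _ => pow_nonneg hy0 i

/-- Choosing an even exponent close to `t` costs nothing compared with the real optimum. -/
lemma exists_even_exponent {t : ℝ} (ht : 1 ≤ t) :
    ∃ r : ℕ, 1 ≤ r ∧ Real.exp (t / (2 * r)) * (2 * r - 1) ≤ Real.exp 1 * t := by
  rcases le_total t 2 with h2 | h2
  · refine ⟨1, le_rfl, ?_⟩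
    have : Real.exp (t / (2 * (1 : ℕ))) ≤ Real.exp 1 := Real.exp_le_exp.2 (by
      push_cast
      linarith)
    push_cast at this ⊢
    nlinarith [Real.exp_pos 1]
  · set r := ⌈t / 2⌉₊ with hr
    have hr1 : t / 2 ≤ r := Nat.le_ceil _
    have hr2 : (r : ℝ) < t / 2 + 1 := Nat.ceil_lt_add_one (by linarith)
    have hr0 : (1 : ℝ) ≤ r := by linarith
    refine ⟨r, by exact_mod_cast hr0, ?_⟩
    obtain ⟨s, hs⟩ : ∃ s, 2 * (r : ℝ) = t + s := ⟨2 * r - t, by ring⟩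
    have hs0 : 0 ≤ s := by linarith
    have hs2 : s ≤ 2 := by linarith
    rw [hs]
    have h₁ : t + s - 1 ≤ t * Real.exp ((s - 1) / t) := by
      have := Real.add_one_le_exp ((s - 1) / t)
      calc t + s - 1 = t * ((s - 1) / t + 1) := by
            field_simp
            ring
        _ ≤ _ := by gcongr
    have h₂ : t / (t + s) + (s - 1) / t ≤ 1 := by
      rw [div_add_div _ _ (by positivity) (by positivity), div_le_one (by positivity)]
      nlinarith
    calc Real.exp (t / (t + s)) * (t + s - 1)
        ≤ Real.exp (t / (t + s)) * (t * Real.exp ((s - 1) / t)) := by gcongr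
      _ = Real.exp (t / (t + s) + (s - 1) / t) * t := by
          rw [Real.exp_add]
          ring
      _ ≤ _ := by gcongr

/-- The binomial coefficient estimate controlling a single Fourier level. -/
lemma level_bound_le {n k m j : ℕ} {η η' : ℝ} (hη' : 2 * Real.log 2 < η') (hη : η' < η)
    (hj : 1 ≤ j) (hjk : j ≤ k) (hn : 1 ≤ n) (hkn : k ≤ n)
    (hnk : 2 * Real.log 2 * n ≤ η' * (n - k)) :
    (Real.exp 1 * (2 * Real.log 2 * m / j)) ^ j / n.choose j ≤
      Real.exp 1 * (1 - η' / η)⁻¹ * (η * m / n) ^ j := by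
  have hlog : 0 < Real.log 2 := Real.log_pos one_lt_two
  have hη'0 : 0 < η' := by linarith
  have hη0 : 0 < η := by linarith
  have hn0 : (0 : ℝ) < n := by exact_mod_cast hn
  have hj0 : (0 : ℝ) < j := by exact_mod_cast hj
  have hnkpos : (0 : ℝ) < n - k := by
    by_contra! h
    nlinarith [mul_pos hlog hn0]
  have hchoose : ((n : ℝ) - k) ^ j / j.factorial ≤ n.choose j := by
    rw [div_le_iff₀ (by positivity)]
    have h := Nat.pow_sub_le_descFactorial n j
    rw [Nat.descFactorial_eq_factorial_mul_choose] at h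
    have h' : ((n + 1 - j : ℕ) : ℝ) ^ j ≤ j.factorial * n.choose j := by exact_mod_cast h
    rw [mul_comm]
    refine le_trans (pow_le_pow_left₀ hnkpos.le ?_ j) h'
    have : n - k ≤ n + 1 - j := by omega
    rw [← Nat.cast_sub hkn]
    exact_mod_cast this
  have hpos : (0 : ℝ) < ((n : ℝ) - k) ^ j / j.factorial := by positivity
  have hfrac : 2 * Real.log 2 * m / (n - k) ≤ η' * m / n := by
    rw [div_le_div_iff₀ hnkpos hn0]
    nlinarith [Nat.cast_nonneg (α := ℝ) m]
  calc (Real.exp 1 * (2 * Real.log 2 * m / j)) ^ j / n.choose j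
      ≤ (Real.exp 1 * (2 * Real.log 2 * m / j)) ^ j / (((n : ℝ) - k) ^ j / j.factorial) := by
        gcongr
    _ = (Real.exp 1 * (2 * Real.log 2 * m / j)) ^ j / ((n : ℝ) - k) ^ j * j.factorial := by
        field_simp
    _ ≤ (Real.exp 1 * (2 * Real.log 2 * m / j)) ^ j / ((n : ℝ) - k) ^ j *
          (Real.exp 1 * j * (j / Real.exp 1) ^ j) := by
        gcongr
        exact factorial_le_mul_div_exp_pow hj
    _ = Real.exp 1 * j * (2 * Real.log 2 * m / (n - k)) ^ j := by
        have : 2 * Real.log 2 * m / (n - k) =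
            Real.exp 1 * (2 * Real.log 2 * m / j) / (n - k) * (j / Real.exp 1) := by
          field_simp
        rw [this, mul_pow, div_pow]
        ring
    _ ≤ Real.exp 1 * j * (η' * m / n) ^ j := by gcongr
    _ = Real.exp 1 * (j * (η' / η) ^ j) * (η * m / n) ^ j := by
        have : η' * m / n = η' / η * (η * m / n) := by field_simp
        rw [this, mul_pow]
        ring
    _ ≤ _ := by
        gcongr
        exact nat_mul_pow_le (by positivity) ((div_lt_one hη0).2 hη) j

section Substring

variable {n k : ℕ} {S : Finset (Fin n)}

lemma substringOf_eq_substringOf_iff (hS : S.card = k) (x y : Fin n → Bool) :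
    (substringOf x S : Fin k → Bool) = substringOf y S ↔ ∀ i ∈ S, x i = y i := by
  simp only [funext_iff, substringOf, hS, dif_pos]
  constructor
  · intro h i hi
    simpa using h ((S.orderIsoOfFin hS).symm ⟨i, hi⟩)
  · exact fun h j => h _ (S.orderIsoOfFin hS j).2

lemma exists_substringOf_eq (hS : S.card = k) (z : Fin k → Bool) :
    ∃ y : Fin n → Bool, substringOf y S = z := by
  refine ⟨fun i => if h : i ∈ S then z ((S.orderIsoOfFin hS).symm ⟨i, h⟩) else false, ?_⟩
  funext j
  simp only [substringOf, hS, ↓reduceDIte, (S.orderIsoOfFin hS j).2, Subtype.coe_eta,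
    OrderIso.symm_apply_apply]

lemma sum_powerset_walsh_mul_walsh (hS : S.card = k) (x y : Fin n → Bool) :
    ∑ T ∈ S.powerset, walsh T x * walsh T y =
      if (substringOf x S : Fin k → Bool) = substringOf y S then 2 ^ k else 0 := by
  simp_rw [walsh, ← Finset.prod_mul_distrib]
  rw [← Finset.prod_one_add]
  simp only [substringOf_eq_substringOf_iff hS]
  split_ifs with h
  · rw [Finset.prod_congr rfl fun i hi => by rw [h i hi, bitSign_mul_self], Finset.prod_const, hS]
    norm_num
  · push Not at h
    obtain ⟨i, hi, hne⟩ := h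
    refine Finset.prod_eq_zero hi ?_
    cases hx : x i <;> cases hy : y i <;> simp_all [bitSign]

/-- Fourier expansion of the probability of guessing the substring indexed by `S`. -/
lemma trace_substringOf_mul_eq {d : Type*} [Fintype d] (hS : S.card = k)
    (M : (Fin k → Bool) → Matrix d d ℂ) (ρ : Matrix d d ℂ)
    {y : (Fin k → Bool) → Fin n → Bool} (hy : ∀ z, substringOf (y z) S = z) (x : Fin n → Bool) :
    (M (substringOf x S) * ρ).trace = (2 ^ k : ℂ)⁻¹ * ∑ T ∈ S.powerset,
      (((walsh T x : ℂ) • ∑ z, (walsh T (y z) : ℂ) • M z) * ρ).trace := by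
  rw [eq_inv_mul_iff_mul_eq₀ (by positivity), ← Matrix.trace_sum, ← Finset.sum_mul]
  simp_rw [Finset.smul_sum, smul_smul]
  rw [Finset.sum_comm]
  simp_rw [← Finset.sum_smul, ← Complex.ofReal_mul, ← Complex.ofReal_sum,
    sum_powerset_walsh_mul_walsh hS, hy]
  simp

end Substring

lemma sum_powersetCard_powerset_comm {α E : Type*} [Fintype α] [DecidableEq α] [AddCommMonoid E]
    (k : ℕ) (g : Finset α → Finset α → E) :
    ∑ S ∈ Finset.univ.powersetCard k, ∑ T ∈ S.powerset, g S T =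
      ∑ j ∈ Finset.range (k + 1), ∑ T ∈ Finset.univ.powersetCard j,
        ∑ S ∈ (Finset.univ.powersetCard k).filter (fun S => T ⊆ S), g S T := by
  have h : ∀ S ∈ (Finset.univ : Finset α).powersetCard k, ∑ T ∈ S.powerset, g S T =
      ∑ j ∈ Finset.range (k + 1), ∑ T ∈ S.powersetCard j, g S T := by
    intro S hS
    rw [Finset.sum_powerset, (Finset.mem_powersetCard.1 hS).2]
  rw [Finset.sum_congr rfl h, Finset.sum_comm]
  refine Finset.sum_congr rfl fun j _ => Finset.sum_comm' fun S T => ?_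
  simp only [Finset.mem_powersetCard, Finset.mem_filter, Finset.subset_univ, true_and]
  tauto

open scoped Matrix.Norms.L2Operator in
/-- A bound on the level-`j` part of the correlation between a family of states indexed by the
cube and a family of observables. -/
lemma level_correlation_le {n m j : ℕ} (hj : 1 ≤ j) (hjn : j ≤ n)
    (hjm : (j : ℝ) ≤ 2 * Real.log 2 * m)
    {f : (Fin n → Bool) → Matrix (Fin (2 ^ m)) (Fin (2 ^ m)) ℂ}
    (hf : ∀ x, (f x).PosSemidef ∧ (f x).trace = 1)
    {B : Finset (Fin n) → Matrix (Fin (2 ^ m)) (Fin (2 ^ m)) ℂ} {w : ℝ} (hw : 0 ≤ w)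
    (hBh : ∀ T ∈ Finset.univ.powersetCard j, (B T).IsHermitian)
    (hB : ∀ T ∈ Finset.univ.powersetCard j, ‖B T‖ ≤ w) :
    (2 ^ n : ℝ)⁻¹ * ∑ x, (Matrix.trace
        ((∑ T ∈ Finset.univ.powersetCard j, (walsh T x : ℂ) • B T) * f x)).re ≤
      w * n.choose j *
        Real.sqrt ((Real.exp 1 * (2 * Real.log 2 * m / j)) ^ j / n.choose j) := by
  have hj0 : (0 : ℝ) < j := by exact_mod_cast hj
  have hN : (0 : ℝ) < n.choose j := by exact_mod_cast Nat.choose_pos hjn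
  set t : ℝ := 2 * Real.log 2 * m / j with ht
  have ht1 : 1 ≤ t := (one_le_div hj0).2 hjm
  obtain ⟨r, hr, hrt⟩ := exists_even_exponent ht1
  have hr1 : (1 : ℝ) ≤ r := by exact_mod_cast hr
  have hq : (0 : ℝ) ≤ 2 * r - 1 := by linarith
  set P : (Fin n → Bool) → Matrix (Fin (2 ^ m)) (Fin (2 ^ m)) ℂ :=
    fun x => ∑ T ∈ Finset.univ.powersetCard j, (walsh T x : ℂ) • B T with hP
  have hPh : ∀ x, (P x).IsHermitian := by
    intro x
    unfold Matrix.IsHermitian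
    rw [hP, Matrix.conjTranspose_sum]
    refine Finset.sum_congr rfl fun T hT => ?_
    rw [Matrix.conjTranspose_smul, (hBh T hT).eq]
    simp
  set X : ℝ := (2 ^ n : ℝ)⁻¹ * ∑ x, (P x * f x).trace.re with hX
  have hjensen : X ^ (2 * r) ≤ (2 ^ n : ℝ)⁻¹ * ∑ x, (P x * f x).trace.re ^ (2 * r) := by
    rw [hX, Finset.mul_sum, Finset.mul_sum]
    refine Real.pow_arith_mean_le_arith_mean_pow_of_even Finset.univ (fun _ => (2 ^ n : ℝ)⁻¹) _
      (fun _ _ => by positivity) ?_ (even_two_mul r)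
    simp
  have htrace : ∑ x, (P x * f x).trace.re ^ (2 * r) ≤ 2 ^ m * ‖∑ x, P x ^ (2 * r)‖ := by
    calc ∑ x, (P x * f x).trace.re ^ (2 * r) ≤ ∑ x, (P x ^ (2 * r)).trace.re :=
          Finset.sum_le_sum fun x _ => re_trace_mul_pow_le (hPh x) (hf x).1 (hf x).2 r
      _ = (∑ x, P x ^ (2 * r)).trace.re := by rw [Matrix.trace_sum, Complex.re_sum]
      _ ≤ ‖(∑ x, P x ^ (2 * r)).trace‖ := Complex.re_le_norm _
      _ ≤ _ := by simpa using norm_trace_le_card_mul (∑ x, P x ^ (2 * r))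
  have hdom : ‖∑ x, P x ^ (2 * r)‖ ≤
      w ^ (2 * r) * (2 ^ n * ((2 * r - 1 : ℝ) ^ j * n.choose j) ^ r) := by
    have h₁ := norm_sum_walsh_smul_pow_le _ B w hB (2 * r) ∅
    have h₂ := sum_sum_walsh_pow_le hr (Finset.univ : Finset (Fin n)) j
    simp only [walsh_empty, Complex.ofReal_one, one_smul, one_mul, ← Finset.mul_sum,
      mul_pow] at h₁
    simp only [Finset.card_univ, Fintype.card_fin] at h₂
    exact h₁.trans (mul_le_mul_of_nonneg_left h₂ (by positivity))
  have hexp : (2 : ℝ) ^ m * ((2 * r - 1 : ℝ) ^ j) ^ r ≤ ((Real.exp 1 * t) ^ j) ^ r := by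
    have h₁ : (2 : ℝ) ^ m = (Real.exp (t / (2 * r)) ^ j) ^ r := by
      rw [← Real.exp_nat_mul, ← Real.exp_nat_mul]
      have : (r : ℝ) * (j * (t / (2 * r))) = m * Real.log 2 := by
        rw [ht]
        field_simp
      rw [this, Real.exp_nat_mul, Real.exp_log two_pos]
    rw [h₁, ← mul_pow, ← mul_pow]
    gcongr
  have hpow : (X ^ 2) ^ r ≤ (w ^ 2 * n.choose j * (Real.exp 1 * t) ^ j) ^ r := by
    calc (X ^ 2) ^ r = X ^ (2 * r) := by rw [pow_mul]
      _ ≤ (2 ^ n : ℝ)⁻¹ * (2 ^ m *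
            (w ^ (2 * r) * (2 ^ n * ((2 * r - 1 : ℝ) ^ j * n.choose j) ^ r))) := by
          refine hjensen.trans (mul_le_mul_of_nonneg_left (htrace.trans ?_) (by positivity))
          exact mul_le_mul_of_nonneg_left hdom (by positivity)
      _ = (w ^ 2 * n.choose j) ^ r * (2 ^ m * ((2 * r - 1 : ℝ) ^ j) ^ r) := by
          rw [mul_pow _ _ r, mul_pow _ _ r, pow_mul w]
          field_simp
      _ ≤ (w ^ 2 * n.choose j) ^ r * ((Real.exp 1 * t) ^ j) ^ r := by gcongr
      _ = _ := by rw [← mul_pow]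
  have hsq := le_of_pow_le_pow_left₀ (by omega) (by positivity) hpow
  refine Real.le_sqrt_of_sq_le hsq |>.trans_eq ?_
  rw [show w ^ 2 * n.choose j * (Real.exp 1 * t) ^ j =
    (w * n.choose j) ^ 2 * ((Real.exp 1 * t) ^ j / n.choose j) by field_simp,
    Real.sqrt_mul (by positivity), Real.sqrt_sq (by positivity)]

open scoped Matrix.Norms.L2Operator in
/-- The contribution of one Fourier level to the average success probability. -/
lemma level_success_le {n k m j : ℕ} (hj : 1 ≤ j) (hjk : j ≤ k) (hkn : k ≤ n)
    (hjm : (j : ℝ) ≤ 2 * Real.log 2 * m)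
    {f : (Fin n → Bool) → Matrix (Fin (2 ^ m)) (Fin (2 ^ m)) ℂ}
    (hf : ∀ x, (f x).PosSemidef ∧ (f x).trace = 1)
    {A : Finset (Fin n) → Finset (Fin n) → Matrix (Fin (2 ^ m)) (Fin (2 ^ m)) ℂ}
    (hAh : ∀ S T, S.card = k → (A S T).IsHermitian)
    (hA : ∀ S T, S.card = k → ‖A S T‖ ≤ 1) :
    (2 ^ n * n.choose k : ℝ)⁻¹ * ∑ x, ∑ T ∈ Finset.univ.powersetCard j,
        ∑ S ∈ (Finset.univ.powersetCard k).filter (fun S => T ⊆ S),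
          (((walsh T x : ℂ) • A S T) * f x).trace.re ≤
      k.choose j * Real.sqrt ((Real.exp 1 * (2 * Real.log 2 * m / j)) ^ j / n.choose j) := by
  have hcard : ∀ {T S : Finset (Fin n)},
      S ∈ (Finset.univ.powersetCard k).filter (fun S => T ⊆ S) → S.card = k := fun hS =>
    (Finset.mem_powersetCard.1 (Finset.mem_filter.1 hS).1).2
  have hNk : (0 : ℝ) < n.choose k := by exact_mod_cast Nat.choose_pos hkn
  have h := level_correlation_le hj (hjk.trans hkn) hjm hf
    (B := fun T => ∑ S ∈ (Finset.univ.powersetCard k).filter (fun S => T ⊆ S), A S T)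
    (w := (n - j).choose (k - j)) (by positivity) ?_ ?_
  · have hsum : ∀ x, ((∑ T ∈ Finset.univ.powersetCard j, (walsh T x : ℂ) •
        ∑ S ∈ (Finset.univ.powersetCard k).filter (fun S => T ⊆ S), A S T) * f x).trace.re =
        ∑ T ∈ Finset.univ.powersetCard j,
          ∑ S ∈ (Finset.univ.powersetCard k).filter (fun S => T ⊆ S),
            (((walsh T x : ℂ) • A S T) * f x).trace.re := by
      intro x
      simp_rw [Finset.smul_sum, Finset.sum_mul, Matrix.trace_sum, Complex.re_sum]
    simp_rw [hsum] at h
    have hch : ((n - j).choose (k - j) : ℝ) * n.choose j = n.choose k * k.choose j := by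
      rw [mul_comm]
      exact_mod_cast (Nat.choose_mul hjk).symm
    rw [hch, mul_assoc] at h
    rw [mul_inv, mul_comm _ (n.choose k : ℝ)⁻¹, mul_assoc, inv_mul_le_iff₀ hNk]
    exact h
  · intro T _
    unfold Matrix.IsHermitian
    rw [Matrix.conjTranspose_sum]
    exact Finset.sum_congr rfl fun S hS => (hAh S T (hcard hS)).eq
  · intro T hT
    have hTc := (Finset.mem_powersetCard.1 hT).2
    refine (norm_sum_le _ _).trans
      ((Finset.sum_le_sum fun S hS => hA S T (hcard hS)).trans_eq ?_)
    rw [Finset.sum_const, card_filter_superset_powersetCard (hTc ▸ hjk), hTc]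
    simp

/-- `k`-out-of-`n` quantum random access code bound: for every `η > 2 ln 2` there are
constants `C, R > 0` such that whenever `k ≤ (2 ln 2)m` and `n ≥ Rk`, every encoding of
`n`-bit strings into `2^m`-dimensional density matrices together with POVMs
`{Mْ_{S,z}}_{z ∈ {0,1}^k}` for each `k`-element subset `S ⊆ [n]` has average success
probability at most `C · (1/2 + (1/2)√(ηm/n))^k`. -/
theorem k_out_of_n_qrac_bound (η : ℝ) (hη : η > 2 * Real.log 2) :
    ∃ C : ℝ, C > 0 ∧ ∃ R : ℝ, R > 0 ∧
      ∀ n k m : ℕ, 1 ≤ n → 1 ≤ k → 1 ≤ m →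
        (k : ℝ) ≤ 2 * Real.log 2 * m → (n : ℝ) ≥ R * k →
        ∀ f : (Fin n → Bool) → Matrix (Fin (2 ^ m)) (Fin (2 ^ m)) ℂ,
          (∀ x, (f x).PosSemidef ∧ (f x).trace = 1) →
        ∀ M : Finset (Fin n) → (Fin k → Bool) → Matrix (Fin (2 ^ m)) (Fin (2 ^ m)) ℂ,
          (∀ S : Finset (Fin n), S.card = k →
            (∀ z, (M S z).PosSemidef) ∧ ∑ z : Fin k → Bool, M S z = 1) →
          ((2 ^ n * n.choose k : ℝ))⁻¹ *
              ∑ x : Fin n → Bool,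
                ∑ S ∈ Finset.powersetCard k (Finset.univ : Finset (Fin n)),
                  (Matrix.trace (M S (substringOf x S) * f x)).re
            ≤ C * (1 / 2 + (1 / 2) * Real.sqrt (η * m / n)) ^ k := by
  have hlog : 0 < Real.log 2 := Real.log_pos one_lt_two
  obtain ⟨η', hη', hη'η⟩ := exists_between hη
  have hη'0 : 0 < η' := by linarith
  have hη0 : 0 < η := by linarith
  have hgap : 0 < η' - 2 * Real.log 2 := by linarith
  refine ⟨1 + Real.sqrt (Real.exp 1 * (1 - η' / η)⁻¹), by positivity,
    η' / (η' - 2 * Real.log 2), by positivity, ?_⟩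
  intro n k m hn hk hm hkm hnk f hf M hM
  set K : ℝ := Real.exp 1 * (1 - η' / η)⁻¹ with hK
  have hK0 : 0 ≤ K := by
    have : η' / η < 1 := (div_lt_one hη0).2 hη'η
    have : 0 < 1 - η' / η := by linarith
    positivity
  have hnk' : 2 * Real.log 2 * n ≤ η' * (n - k) := by
    rw [ge_iff_le, div_mul_eq_mul_div, div_le_iff₀ hgap] at hnk
    linarith
  have hkn : k ≤ n := by
    have : (0 : ℝ) ≤ n - k := by
      by_contra! h
      have : (0 : ℝ) ≤ 2 * Real.log 2 * n := by positivity
      nlinarith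
    exact_mod_cast sub_nonneg.1 this
  have hNk : (0 : ℝ) < n.choose k := by exact_mod_cast Nat.choose_pos hkn
  have hex : ∀ (S : Finset (Fin n)) (z : Fin k → Bool),
      ∃ y : Fin n → Bool, S.card = k → substringOf y S = z := by
    intro S z
    by_cases hS : S.card = k
    · obtain ⟨y, hy⟩ := exists_substringOf_eq hS z
      exact ⟨y, fun _ => hy⟩
    · exact ⟨fun _ => false, fun h => absurd h hS⟩
  choose y hy using hex
  set A : Finset (Fin n) → Finset (Fin n) → Matrix (Fin (2 ^ m)) (Fin (2 ^ m)) ℂ :=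
    fun S T => ∑ z, (walsh T (y S z) : ℂ) • M S z with hA
  set L : ℕ → ℝ := fun j => (2 ^ n * n.choose k : ℝ)⁻¹ *
    ∑ x, ∑ T ∈ Finset.univ.powersetCard j,
      ∑ S ∈ (Finset.univ.powersetCard k).filter (fun S => T ⊆ S),
        (((walsh T x : ℂ) • A S T) * f x).trace.re with hL
  have hfourier : (2 ^ n * n.choose k : ℝ)⁻¹ * ∑ x,
      ∑ S ∈ Finset.univ.powersetCard k, (Matrix.trace (M S (substringOf x S) * f x)).re =
      (2 ^ k : ℝ)⁻¹ * ∑ j ∈ Finset.range (k + 1), L j := by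
    have hswap : ∑ j ∈ Finset.range (k + 1), L j = (2 ^ n * n.choose k : ℝ)⁻¹ *
        ∑ x, ∑ S ∈ Finset.univ.powersetCard k, ∑ T ∈ S.powerset,
          (((walsh T x : ℂ) • A S T) * f x).trace.re := by
      simp_rw [hL, sum_powersetCard_powerset_comm]
      rw [← Finset.mul_sum, Finset.sum_comm]
    rw [hswap, mul_left_comm, Finset.mul_sum (a := (2 ^ k : ℝ)⁻¹)]
    congr 1
    refine Finset.sum_congr rfl fun x _ => ?_
    rw [Finset.mul_sum]
    refine Finset.sum_congr rfl fun S hS => ?_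
    have hS := (Finset.mem_powersetCard.1 hS).2
    rw [trace_substringOf_mul_eq hS (M S) (f x) (fun z => hy S z hS) x, ← Complex.re_sum,
      show (2 ^ k : ℂ)⁻¹ = ((2 ^ k : ℝ)⁻¹ : ℝ) by push_cast; rfl, Complex.re_ofReal_mul]
  have hlevel : ∀ j ∈ Finset.range (k + 1),
      L j ≤ (1 + Real.sqrt K) * (Real.sqrt (η * m / n) ^ j * k.choose j) := by
    intro j hj
    have hjk : j ≤ k := by simpa [Nat.lt_succ_iff] using hj
    rcases Nat.eq_zero_or_pos j with rfl | hj1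
    · have hS : ∀ x, ∀ S ∈ (Finset.univ : Finset (Fin n)).powersetCard k,
          (A S ∅ * f x).trace.re = 1 := by
        intro x S hS
        have hS := (Finset.mem_powersetCard.1 hS).2
        simp [hA, (hM S hS).2, (hf x).2]
      have : L 0 = 1 := by
        simp only [hL, Finset.powersetCard_zero, Finset.sum_singleton, walsh_empty,
          Complex.ofReal_one, one_smul, Finset.empty_subset, Finset.filter_true]
        rw [Finset.sum_congr rfl fun x _ => Finset.sum_congr rfl (hS x)]
        simp
        field_simp
      simp [this, Real.sqrt_nonneg]
    · have hjm : (j : ℝ) ≤ 2 * Real.log 2 * m := le_trans (by exact_mod_cast hjk) hkm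
      have h := level_success_le (A := A) hj1 hjk hkn hjm hf
        (fun S T hS => isHermitian_sum_ofReal_smul (fun z => ((hM S hS).1 z).isHermitian) _)
        (fun S T hS => norm_sum_smul_le_one (hM S hS).1 (hM S hS).2
          fun z => (abs_walsh T (y S z)).le)
      refine h.trans ?_
      have hs : Real.sqrt ((Real.exp 1 * (2 * Real.log 2 * m / j)) ^ j / n.choose j) ≤
          Real.sqrt K * Real.sqrt (η * m / n) ^ j := by
        refine (Real.sqrt_le_sqrt (level_bound_le hη' hη'η hj1 hjk hn hkn hnk')).trans_eq ?_
        rw [Real.sqrt_mul hK0]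
        congr 1
        rw [Real.sqrt_eq_iff_mul_self_eq (by positivity) (by positivity), ← mul_pow,
          Real.mul_self_sqrt (by positivity)]
      calc (k.choose j : ℝ) * _ ≤ k.choose j * (Real.sqrt K * Real.sqrt (η * m / n) ^ j) := by
            gcongr
        _ ≤ k.choose j * ((1 + Real.sqrt K) * Real.sqrt (η * m / n) ^ j) := by
            gcongr
            linarith
        _ = _ := by ring
  rw [hfourier]
  calc (2 ^ k : ℝ)⁻¹ * ∑ j ∈ Finset.range (k + 1), L j
      ≤ (2 ^ k : ℝ)⁻¹ * ∑ j ∈ Finset.range (k + 1),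
          (1 + Real.sqrt K) * (Real.sqrt (η * m / n) ^ j * k.choose j) := by
        gcongr with j hj
        exact hlevel j hj
    _ = (1 + Real.sqrt K) * ((2 ^ k : ℝ)⁻¹ * (Real.sqrt (η * m / n) + 1) ^ k) := by
        rw [← Finset.mul_sum, add_pow]
        simp only [one_pow, mul_one]
        ring
    _ = _ := by
        rw [← inv_pow, ← mul_pow]
        congr 2
        ring
end

section
/- Let n, N ≥ 1 be integers, let δ, ε ∈ (0,1], and let C : {±1}^n → {±1}^N. Suppose that for every i ∈ [n] there is a family M_i of pairwise disjoint 2-element subsets of [N] with |M_i| ≥ δεN/4, and for every Q = {j,k} ∈ M_i a sign a_{i,Q} ∈ {±1}, such that 2^{-n}·∑_{x ∈ {±1}^n} a_{i,Q} · x_i · C(x)_j · C(x)_k ≥ ε/4. Then for every real p with 1 < p ≤ 2: n·(p-1)·(δε/2)^{2/p}·(ε/4)² ≤ N^{2(p-1)/p}. -/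
/-- Interpret a Boolean as an element of `{±1} ⊆ ℝ`. -/
def pmOne (b : Bool) : ℝ := if b then 1 else -1

open Finset Matrix

section QuadraticForm

variable {ι : Type*} [Fintype ι]

lemma dotProduct_sq_le (u w : ι → ℝ) : (u ⬝ᵥ w) ^ 2 ≤ (u ⬝ᵥ u) * (w ⬝ᵥ w) := by
  simpa [dotProduct, sq] using Finset.sum_mul_sq_le_sq_mul_sq univ u w

lemma dotProduct_mulVec_pow_le [DecidableEq ι] {A : Matrix ι ι ℝ} (hA : Aᵀ = A) (v : ι → ℝ) {k : ℕ}
    (hk : 1 ≤ k) :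
    (v ⬝ᵥ A *ᵥ v) ^ (2 * k) ≤ (v ⬝ᵥ v) ^ (2 * k) * (A ^ (2 * k)).trace := by
  set a : ℕ → ℝ := fun j => (A ^ j *ᵥ v) ⬝ᵥ (A ^ j *ᵥ v) with ha
  have nonneg (u : ι → ℝ) : 0 ≤ u ⬝ᵥ u := Finset.sum_nonneg fun i _ => mul_self_nonneg (u i)
  have symm (u w : ι → ℝ) : (A *ᵥ u) ⬝ᵥ w = u ⬝ᵥ (A *ᵥ w) := by
    rw [dotProduct_mulVec, ← mulVec_transpose, hA]
  have a0 : a 0 = v ⬝ᵥ v := by simp [ha]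
  have logconvex (j : ℕ) : a (j + 1) ^ 2 ≤ a j * a (j + 2) := by
    have : a (j + 1) = (A ^ j *ᵥ v) ⬝ᵥ (A ^ (j + 2) *ᵥ v) := by
      simp only [ha]
      rw [pow_succ' A j, ← mulVec_mulVec, symm, mulVec_mulVec, mulVec_mulVec, mul_assoc,
        ← pow_succ', ← pow_succ']
    rw [this]
    exact dotProduct_sq_le _ _
  have ratio (j : ℕ) : a 1 * a j ≤ a 0 * a (j + 1) := by
    induction j with
    | zero => rw [mul_comm]
    | succ j ih =>
      have h0 : 0 ≤ a j := nonneg _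
      have h1 : 0 ≤ a (j + 1) := nonneg _
      rcases h0.eq_or_lt with h | h
      · have := logconvex j
        rw [← h, zero_mul] at this
        have h' : a (j + 1) = 0 := by nlinarith
        rw [h', mul_zero]
        exact mul_nonneg (nonneg _) (nonneg _)
      · refine le_of_mul_le_mul_left ?_ h
        have hl := mul_le_mul_of_nonneg_left (logconvex j) (nonneg _ : 0 ≤ a 0)
        have hr := mul_le_mul_of_nonneg_right ih h1
        nlinarith
  have power (j : ℕ) : a 1 ^ (j + 1) ≤ a 0 ^ j * a (j + 1) := by
    induction j with
    | zero => simp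
    | succ j ih =>
      calc a 1 ^ (j + 2) = a 1 * a 1 ^ (j + 1) := pow_succ' _ _
        _ ≤ a 1 * (a 0 ^ j * a (j + 1)) := mul_le_mul_of_nonneg_left ih (nonneg _)
        _ = a 0 ^ j * (a 1 * a (j + 1)) := by ring
        _ ≤ a 0 ^ j * (a 0 * a (j + 2)) :=
          mul_le_mul_of_nonneg_left (ratio _) (pow_nonneg (nonneg _) _)
        _ = a 0 ^ (j + 1) * a (j + 2) := by ring
  have first : (v ⬝ᵥ A *ᵥ v) ^ 2 ≤ a 0 * a 1 := by
    simpa [ha] using dotProduct_sq_le v (A *ᵥ v)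
  have last : a k ≤ a 0 * (A ^ (2 * k)).trace := by
    have hAk : (A ^ k)ᵀ = A ^ k := by rw [transpose_pow, hA]
    have htr : (A ^ (2 * k)).trace = ∑ i, (A ^ k) i ⬝ᵥ (A ^ k) i := by
      rw [two_mul, pow_add]
      nth_rewrite 2 [← hAk]
      rfl
    rw [htr, mul_sum, a0]
    refine Finset.sum_le_sum fun i _ => ?_
    have := dotProduct_sq_le ((A ^ k) i) v
    rw [mul_comm, sq] at this
    exact this.trans_eq (by ring)
  obtain ⟨j, rfl⟩ : ∃ j, k = j + 1 := ⟨k - 1, by omega⟩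
  have ha0 : 0 ≤ a 0 := nonneg _
  calc (v ⬝ᵥ A *ᵥ v) ^ (2 * (j + 1)) = ((v ⬝ᵥ A *ᵥ v) ^ 2) ^ (j + 1) := pow_mul _ _ _
    _ ≤ (a 0 * a 1) ^ (j + 1) := pow_le_pow_left₀ (sq_nonneg _) first _
    _ = a 0 ^ (j + 1) * a 1 ^ (j + 1) := mul_pow _ _ _
    _ ≤ a 0 ^ (j + 1) * (a 0 ^ j * (a 0 * (A ^ (2 * (j + 1))).trace)) := by
      gcongr
      exact (power j).trans (mul_le_mul_of_nonneg_left last (pow_nonneg ha0 _))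
    _ = (v ⬝ᵥ v) ^ (2 * (j + 1)) * (A ^ (2 * (j + 1))).trace := by rw [← a0]; ring

end QuadraticForm

section Cube

variable {n : ℕ}

lemma pmOne_mul_self (b : Bool) : pmOne b * pmOne b = 1 := by cases b <;> simp [pmOne]

lemma pmOne_not (b : Bool) : pmOne (!b) = -pmOne b := by cases b <;> simp [pmOne]

lemma sum_prod_pmOne_nonneg {r : ℕ} (w : Fin r → Fin n) :
    0 ≤ ∑ x : Fin n → Bool, ∏ t, pmOne (x (w t)) := by
  have h (x : Fin n → Bool) :
      ∏ t, pmOne (x (w t)) = ∏ i, pmOne (x i) ^ #{t | w t = i} := by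
    rw [← Finset.prod_fiberwise univ w]
    refine Finset.prod_congr rfl fun i _ => ?_
    rw [Finset.prod_congr rfl (g := fun _ => pmOne (x i))
      (fun t ht => by rw [(Finset.mem_filter.1 ht).2]), Finset.prod_const]
  simp_rw [h]
  rw [← Fintype.prod_sum (fun i b => pmOne b ^ #{t | w t = i})]
  refine Finset.prod_nonneg fun i _ => ?_
  rcases neg_one_pow_eq_or ℝ #{t | w t = i} with h | h <;> simp [pmOne, h]

lemma sum_pow_mul_pow_le (a b : ℝ) (l : ℕ) :
    2 * ∑ j ∈ range (2 * l + 1), a ^ j * b ^ (2 * l - j)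
      ≤ (2 * l + 1) * (a ^ (2 * l) + b ^ (2 * l)) := by
  have hrefl := Finset.sum_range_reflect (fun j => a ^ j * b ^ (2 * l - j)) (2 * l + 1)
  rw [two_mul]
  nth_rewrite 1 [← hrefl]
  rw [← Finset.sum_add_distrib]
  refine (Finset.sum_le_card_nsmul _ _ (a ^ (2 * l) + b ^ (2 * l)) fun j hj => ?_).trans_eq
    (by simp [mul_add])
  obtain ⟨i, hi⟩ : ∃ i, 2 * l = i + j := ⟨2 * l - j, by simp at hj; omega⟩
  have e1 : 2 * l + 1 - 1 - j = i := by omega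
  have e2 : 2 * l - i = j := by omega
  have e3 : 2 * l - j = i := by omega
  have ha : a ^ (2 * l) = |a| ^ i * |a| ^ j := by
    rw [← pow_add, ← hi, (even_two_mul l).pow_abs]
  have hb : b ^ (2 * l) = |b| ^ i * |b| ^ j := by
    rw [← pow_add, ← hi, (even_two_mul l).pow_abs]
  rw [e1, e2, e3, ha, hb]
  have h1 : a ^ i * b ^ j ≤ |a| ^ i * |b| ^ j :=
    (le_abs_self _).trans_eq (by rw [abs_mul, abs_pow, abs_pow])
  have h2 : a ^ j * b ^ i ≤ |a| ^ j * |b| ^ i :=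
    (le_abs_self _).trans_eq (by rw [abs_mul, abs_pow, abs_pow])
  have h3 : 0 ≤ (|a| ^ i - |b| ^ i) * (|a| ^ j - |b| ^ j) := by
    rcases le_total |a| |b| with h | h
    · exact mul_nonneg_of_nonpos_of_nonpos
        (sub_nonpos.2 (pow_le_pow_left₀ (abs_nonneg _) h _))
        (sub_nonpos.2 (pow_le_pow_left₀ (abs_nonneg _) h _))
    · exact mul_nonneg
        (sub_nonneg.2 (pow_le_pow_left₀ (abs_nonneg _) h _))
        (sub_nonneg.2 (pow_le_pow_left₀ (abs_nonneg _) h _))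
  nlinarith

lemma sum_rademacher_pow_succ_le (l : ℕ) :
    ∑ x : Fin n → Bool, (∑ i, pmOne (x i)) ^ (2 * (l + 1))
      ≤ n * (2 * l + 1) * ∑ x : Fin n → Bool, (∑ i, pmOne (x i)) ^ (2 * l) := by
  set S : (Fin n → Bool) → ℝ := fun x => ∑ i, pmOne (x i) with hS
  have key (i : Fin n) :
      ∑ x, pmOne (x i) * S x ^ (2 * l + 1) ≤ (2 * l + 1) * ∑ x, S x ^ (2 * l) := by
    let flip : (Fin n → Bool) ≃ (Fin n → Bool) :=
      Function.Involutive.toPerm (fun x => Function.update x i (!x i)) fun x => by simp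
    have flip_apply (x) : flip x = Function.update x i (!x i) := rfl
    have flip_i (x) : pmOne (flip x i) = -pmOne (x i) := by
      rw [flip_apply, Function.update_self, pmOne_not]
    have flip_S (x) : S (flip x) = S x - 2 * pmOne (x i) := by
      simp only [hS]
      rw [← Finset.add_sum_erase _ _ (mem_univ i), ← Finset.add_sum_erase univ
        (fun j => pmOne (x j)) (mem_univ i), flip_i, Finset.sum_congr rfl
        (g := fun j => pmOne (x j))]
      · ring
      · intro j hj
        rw [flip_apply, Function.update_of_ne (Finset.ne_of_mem_erase hj)]
    have h1 : ∑ x, pmOne (x i) * S x ^ (2 * l + 1)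
        = ∑ x, -pmOne (x i) * S (flip x) ^ (2 * l + 1) := by
      rw [← Equiv.sum_comp flip]
      simp_rw [flip_i]
    have h2 : ∑ x, S x ^ (2 * l) = ∑ x, S (flip x) ^ (2 * l) := (Equiv.sum_comp flip _).symm
    have h3 : 2 * ∑ x, pmOne (x i) * S x ^ (2 * l + 1)
        ≤ (2 * l + 1) * (∑ x, S x ^ (2 * l) + ∑ x, S (flip x) ^ (2 * l)) := by
      rw [two_mul]
      nth_rewrite 2 [h1]
      rw [← Finset.sum_add_distrib, ← Finset.sum_add_distrib, mul_sum]
      refine Finset.sum_le_sum fun x _ => ?_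
      refine le_trans (le_of_eq ?_) (sum_pow_mul_pow_le (S x) (S (flip x)) l)
      have hg := (Commute.all (S x) (S (flip x))).mul_geom_sum₂ (2 * l + 1)
      have hsq := pmOne_mul_self (x i)
      have hd : S x - S (flip x) = 2 * pmOne (x i) := by rw [flip_S]; ring
      rw [hd] at hg
      calc _ = pmOne (x i) * (S x ^ (2 * l + 1) - S (flip x) ^ (2 * l + 1)) := by ring
        _ = 2 * (pmOne (x i) * pmOne (x i)) *
            ∑ j ∈ range (2 * l + 1), S x ^ j * S (flip x) ^ (2 * l - j) := by
          rw [← hg, Nat.add_sub_cancel]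
          ring
        _ = _ := by rw [hsq, mul_one]
    rw [← h2] at h3
    linarith
  calc ∑ x, S x ^ (2 * (l + 1)) = ∑ i, ∑ x, pmOne (x i) * S x ^ (2 * l + 1) := by
        rw [Finset.sum_comm]
        refine Finset.sum_congr rfl fun x _ => ?_
        rw [← Finset.sum_mul, mul_add, mul_one, ← pow_succ']
    _ ≤ ∑ _i : Fin n, (2 * l + 1) * ∑ x, S x ^ (2 * l) := Finset.sum_le_sum fun i _ => key i
    _ = _ := by rw [Finset.sum_const, card_univ, Fintype.card_fin, nsmul_eq_mul]; ring

lemma sum_rademacher_pow_le (k : ℕ) :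
    ∑ x : Fin n → Bool, (∑ i, pmOne (x i)) ^ (2 * k) ≤ 2 ^ n * (k * n : ℝ) ^ k := by
  have h : (2 ^ k * k.factorial : ℝ) * ∑ x : Fin n → Bool, (∑ i, pmOne (x i)) ^ (2 * k)
      ≤ (2 * k).factorial * (2 ^ n * n ^ k) := by
    induction k with
    | zero => simp
    | succ k ih =>
      have hs := sum_rademacher_pow_succ_le (n := n) k
      have hf : ((2 * (k + 1)).factorial : ℝ) = (2 * k + 2) * (2 * k + 1) * (2 * k).factorial := by
        rw [show 2 * (k + 1) = 2 * k + 1 + 1 by ring, Nat.factorial_succ, Nat.factorial_succ]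
        push_cast
        ring
      rw [hf, Nat.factorial_succ]
      push_cast
      calc _ ≤ (2 ^ (k + 1) * ((k + 1) * k.factorial) : ℝ) *
            (n * (2 * k + 1) * ∑ x : Fin n → Bool, (∑ i, pmOne (x i)) ^ (2 * k)) :=
            mul_le_mul_of_nonneg_left hs (by positivity)
        _ = (2 * k + 2) * (2 * k + 1) * n * ((2 ^ k * k.factorial : ℝ) *
            ∑ x : Fin n → Bool, (∑ i, pmOne (x i)) ^ (2 * k)) := by ring
        _ ≤ (2 * k + 2) * (2 * k + 1) * n * ((2 * k).factorial * (2 ^ n * n ^ k)) :=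
            mul_le_mul_of_nonneg_left ih (by positivity)
        _ = _ := by ring
  have hf : ((2 * k).factorial : ℝ) ≤ (2 * k) ^ k * k.factorial := by
    exact_mod_cast Nat.factorial_two_mul_le k
  have hpos : (0 : ℝ) < 2 ^ k * k.factorial := by positivity
  refine le_of_mul_le_mul_left (h.trans ?_) hpos
  calc _ ≤ ((2 * k) ^ k * k.factorial : ℝ) * (2 ^ n * n ^ k) :=
        mul_le_mul_of_nonneg_right hf (by positivity)
    _ = _ := by rw [mul_pow, mul_pow]; ring

end Cube

section TraceMoment

variable {ι : Type*} [Fintype ι]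

lemma sum_smul_pow [DecidableEq ι] {n : ℕ} (c : Fin n → ℝ) (B : Fin n → Matrix ι ι ℝ) (r : ℕ) :
    (∑ i, c i • B i) ^ r
      = ∑ w : Fin r → Fin n, (∏ t, c (w t)) • (List.ofFn fun t => B (w t)).prod := by
  induction r with
  | zero => simp
  | succ r ih =>
    rw [pow_succ', ih, ← Equiv.sum_comp (Fin.consEquiv fun _ => Fin n), Fintype.sum_prod_type,
      Finset.sum_mul_sum]
    refine Finset.sum_congr rfl fun i _ => Finset.sum_congr rfl fun w _ => ?_
    simp [Fin.prod_univ_succ, Fin.consEquiv, List.ofFn_succ, smul_smul, mul_comm]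

lemma sum_abs_mul_le (P Q : Matrix ι ι ℝ) (hQ : ∀ a, ∑ b, |Q a b| ≤ 1) (a : ι) :
    ∑ b, |(P * Q) a b| ≤ ∑ c, |P a c| :=
  calc ∑ b, |(P * Q) a b| ≤ ∑ b, ∑ c, |P a c| * |Q c b| := by
        refine Finset.sum_le_sum fun b _ => ?_
        rw [mul_apply]
        exact (Finset.abs_sum_le_sum_abs _ _).trans_eq (by simp_rw [abs_mul])
    _ = ∑ c, |P a c| * ∑ b, |Q c b| := by
        rw [Finset.sum_comm]
        simp_rw [mul_sum]
    _ ≤ ∑ c, |P a c| :=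
        Finset.sum_le_sum fun c _ => mul_le_of_le_one_right (abs_nonneg _) (hQ c)

lemma sum_abs_list_prod_le [DecidableEq ι] (L : List (Matrix ι ι ℝ)) (hL : ∀ Q ∈ L, ∀ a, ∑ b, |Q a b| ≤ 1)
    (a : ι) : ∑ b, |L.prod a b| ≤ 1 := by
  induction L generalizing a with
  | nil => simp [one_apply, apply_ite abs]
  | cons Q L ih =>
    rw [List.prod_cons]
    exact (sum_abs_mul_le Q L.prod (ih fun P hP => hL P (List.mem_cons_of_mem _ hP)) a).trans
      (hL Q List.mem_cons_self a)

lemma sum_trace_pow_le [DecidableEq ι] {n : ℕ} (B : Fin n → Matrix ι ι ℝ) {T : ℝ}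
    (hrow : ∀ i a, ∑ b, |B i a b| ≤ 1) (hT : ∀ i, ∑ a, ∑ b, |B i a b| ≤ T) {r : ℕ} (hr : 1 ≤ r) :
    ∑ x : Fin n → Bool, ((∑ i, pmOne (x i) • B i) ^ r).trace
      ≤ T * ∑ x : Fin n → Bool, (∑ i, pmOne (x i)) ^ r := by
  have htrace (w : Fin r → Fin n) : (List.ofFn fun t => B (w t)).prod.trace ≤ T := by
    obtain ⟨s, rfl⟩ : ∃ s, r = s + 1 := ⟨r - 1, by omega⟩
    rw [List.ofFn_succ, List.prod_cons]
    refine le_trans ?_ (hT (w 0))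
    refine Finset.sum_le_sum fun a _ => ?_
    set L := List.ofFn fun t : Fin s => B (w t.succ) with hL
    have hLrow : ∀ Q ∈ L, ∀ a, ∑ b, |Q a b| ≤ 1 := by
      intro Q hQ
      obtain ⟨t, rfl⟩ := List.mem_ofFn.1 hQ
      exact hrow _
    refine le_trans ?_ (sum_abs_mul_le (B (w 0)) L.prod (sum_abs_list_prod_le L hLrow) a)
    exact (le_abs_self _).trans (Finset.single_le_sum (f := fun b => |(B (w 0) * L.prod) a b|)
      (fun b _ => abs_nonneg _) (mem_univ a))
  simp_rw [sum_smul_pow, Fintype.sum_pow, trace_sum, trace_smul, smul_eq_mul]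
  rw [Finset.sum_comm]
  conv_rhs => rw [Finset.sum_comm]
  rw [mul_sum]
  refine Finset.sum_le_sum fun w _ => ?_
  rw [← Finset.sum_mul, mul_comm T]
  exact mul_le_mul_of_nonneg_left (htrace w) (sum_prod_pmOne_nonneg w)

end TraceMoment

section Matching

variable {ι : Type*} [DecidableEq ι]

/-- The symmetric matrix with entry `σ {a, b}` at `(a, b)` when `{a, b} ∈ M`, and `0` elsewhere. -/
def matchingMatrix (M : Finset (Finset ι)) (σ : Finset ι → ℝ) : Matrix ι ι ℝ :=
  fun a b => if {a, b} ∈ M then σ {a, b} else 0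

lemma matchingMatrix_transpose (M : Finset (Finset ι)) (σ : Finset ι → ℝ) :
    (matchingMatrix M σ)ᵀ = matchingMatrix M σ := by
  ext a b
  simp [matchingMatrix, Finset.pair_comm]

variable [Fintype ι]

lemma sum_pair_mem {M : Finset (Finset ι)} (hM : ∀ Q ∈ M, #Q = 2) (F : Finset ι → ℝ) :
    ∑ a, ∑ b, (if {a, b} ∈ M then F {a, b} else 0) = 2 * ∑ Q ∈ M, F Q := by
  have h (a b : ι) : (if {a, b} ∈ M then F {a, b} else 0)
      = ∑ Q ∈ M, if {a, b} = Q then F Q else 0 := by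
    rw [Finset.sum_ite_eq]
  simp_rw [h]
  rw [Finset.sum_congr rfl fun a _ => Finset.sum_comm, Finset.sum_comm, mul_sum]
  refine Finset.sum_congr rfl fun Q hQ => ?_
  obtain ⟨c, d, hcd, rfl⟩ := Finset.card_eq_two.1 (hM Q hQ)
  rw [← Fintype.sum_prod_type' (f := fun a b => if ({a, b} : Finset ι) = {c, d} then F {c, d} else 0),
    ← Finset.sum_filter]
  have : (univ.filter fun z : ι × ι => ({z.1, z.2} : Finset ι) = {c, d}) = {(c, d), (d, c)} := by
    ext ⟨a, b⟩
    simp only [mem_filter, mem_univ, true_and, mem_insert, mem_singleton, Prod.mk.injEq]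
    constructor
    · intro h
      have := congrArg (fun s : Finset ι => (s : Set ι)) h
      simpa [Set.pair_eq_pair_iff] using this
    · rintro (⟨rfl, rfl⟩ | ⟨rfl, rfl⟩)
      · rfl
      · exact Finset.pair_comm _ _
  rw [this, Finset.sum_const, Finset.card_pair (by simp [hcd])]
  simp

lemma sum_abs_matchingMatrix {M : Finset (Finset ι)} {σ : Finset ι → ℝ} (hM : ∀ Q ∈ M, #Q = 2)
    (hσ : ∀ Q ∈ M, |σ Q| = 1) : ∑ a, ∑ b, |matchingMatrix M σ a b| = 2 * #M := by
  simp_rw [matchingMatrix, apply_ite abs, abs_zero]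
  rw [sum_pair_mem hM fun Q => |σ Q|, Finset.sum_congr rfl hσ]
  simp

lemma sum_abs_matchingMatrix_row_le {M : Finset (Finset ι)} {σ : Finset ι → ℝ}
    (hM : ∀ Q ∈ M, #Q = 2) (hdisj : ∀ Q ∈ M, ∀ Q' ∈ M, Q ≠ Q' → Disjoint Q Q')
    (hσ : ∀ Q ∈ M, |σ Q| = 1) (a : ι) : ∑ b, |matchingMatrix M σ a b| ≤ 1 := by
  have h (b : ι) : |matchingMatrix M σ a b| = if {a, b} ∈ M then 1 else 0 := by
    unfold matchingMatrix
    split_ifs with h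
    · exact hσ _ h
    · exact abs_zero
  simp_rw [h]
  rw [Finset.sum_boole]
  norm_cast
  refine Finset.card_le_one.2 fun b hb c hc => ?_
  simp only [mem_filter, mem_univ, true_and] at hb hc
  have hbc : ({a, b} : Finset ι) = {a, c} := by
    by_contra hne
    exact Finset.disjoint_left.1 (hdisj _ hb _ hc hne) (mem_insert_self a _) (mem_insert_self a _)
  have hab : a ≠ b := by
    rintro rfl
    simpa using hM _ hb
  have : b ∈ ({a, c} : Finset ι) := hbc ▸ (by simp)
  simpa [hab.symm] using this

lemma dotProduct_matchingMatrix_mulVec {M : Finset (Finset ι)} (hM : ∀ Q ∈ M, #Q = 2)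
    (σ : Finset ι → ℝ) (v : ι → ℝ) :
    v ⬝ᵥ matchingMatrix M σ *ᵥ v = 2 * ∑ Q ∈ M, σ Q * ∏ j ∈ Q, v j := by
  rw [← sum_pair_mem hM]
  simp only [dotProduct, mulVec, mul_sum]
  refine Finset.sum_congr rfl fun a _ => Finset.sum_congr rfl fun b _ => ?_
  unfold matchingMatrix
  split_ifs with h
  · have hab : a ≠ b := by
      rintro rfl
      simpa using hM _ h
    rw [Finset.prod_pair hab]
    ring
  · ring

end Matching

lemma bias_pow_le {n N m : ℕ} (hm : 1 ≤ m) (hn : 1 ≤ n) (hN : 1 ≤ N) {η : ℝ} (hη : 0 ≤ η)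
    (C : (Fin n → Bool) → (Fin N → Bool)) (M : Fin n → Finset (Finset (Fin N)))
    (σ : Fin n → Finset (Fin N) → ℝ) (hM : ∀ i, ∀ Q ∈ M i, #Q = 2)
    (hdisj : ∀ i, ∀ Q ∈ M i, ∀ Q' ∈ M i, Q ≠ Q' → Disjoint Q Q')
    (hcard : ∀ i, #(M i) = m) (hσ : ∀ i, ∀ Q ∈ M i, |σ i Q| = 1)
    (hbias : ∀ i, ∀ Q ∈ M i, η ≤ (2 ^ n : ℝ)⁻¹ *
      ∑ x : Fin n → Bool, σ i Q * pmOne (x i) * ∏ j ∈ Q, pmOne (C x j))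
    {k : ℕ} (hk : 1 ≤ k) :
    (n * η ^ 2 * (2 * m / N : ℝ) ^ 2) ^ k ≤ (k : ℝ) ^ k * (2 * m) := by
  set B : Fin n → Matrix (Fin N) (Fin N) ℝ := fun i => matchingMatrix (M i) (σ i) with hB
  set A : (Fin n → Bool) → Matrix (Fin N) (Fin N) ℝ := fun x => ∑ i, pmOne (x i) • B i with hA
  set v : (Fin n → Bool) → Fin N → ℝ := fun x j => pmOne (C x j) with hv
  have hvv (x) : v x ⬝ᵥ v x = N := by simp [hv, dotProduct, pmOne_mul_self]
  have hAsymm (x) : (A x)ᵀ = A x := by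
    simp [hA, hB, transpose_sum, matchingMatrix_transpose]
  have hform (x) : v x ⬝ᵥ A x *ᵥ v x
      = 2 * ∑ i, ∑ Q ∈ M i, σ i Q * pmOne (x i) * ∏ j ∈ Q, pmOne (C x j) := by
    simp only [hA, hB, sum_mulVec, smul_mulVec, dotProduct_sum, dotProduct_smul,
      dotProduct_matchingMatrix_mulVec (hM _), mul_sum, smul_eq_mul, hv]
    refine Finset.sum_congr rfl fun i _ => Finset.sum_congr rfl fun Q _ => ?_
    ring
  have hlower : 2 * n * m * η ≤ ∑ x, (2 ^ n : ℝ)⁻¹ * (v x ⬝ᵥ A x *ᵥ v x) := by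
    have : ∑ x, (2 ^ n : ℝ)⁻¹ * (v x ⬝ᵥ A x *ᵥ v x) = 2 * ∑ i, ∑ Q ∈ M i, (2 ^ n : ℝ)⁻¹ *
        ∑ x : Fin n → Bool, σ i Q * pmOne (x i) * ∏ j ∈ Q, pmOne (C x j) := by
      simp_rw [hform]
      simp only [mul_sum]
      rw [Finset.sum_comm]
      refine Finset.sum_congr rfl fun i _ => ?_
      rw [Finset.sum_comm]
      refine Finset.sum_congr rfl fun Q _ => Finset.sum_congr rfl fun x _ => ?_
      ring
    rw [this]
    have h : ∑ i : Fin n, ∑ _Q ∈ M i, η = n * m * η := by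
      simp [hcard, mul_assoc]
    rw [mul_assoc, mul_assoc, ← mul_assoc (n : ℝ), ← h]
    gcongr with i _ Q hQ
    exact hbias i Q hQ
  have hjensen : (∑ x, (2 ^ n : ℝ)⁻¹ * (v x ⬝ᵥ A x *ᵥ v x)) ^ (2 * k)
      ≤ ∑ x, (2 ^ n : ℝ)⁻¹ * (v x ⬝ᵥ A x *ᵥ v x) ^ (2 * k) :=
    Real.pow_arith_mean_le_arith_mean_pow_of_even univ _ _ (fun _ _ => by positivity)
      (by simp) (even_two_mul k)
  have hupper : ∑ x, (2 ^ n : ℝ)⁻¹ * (v x ⬝ᵥ A x *ᵥ v x) ^ (2 * k)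
      ≤ N ^ (2 * k) * (2 * m * (k * n) ^ k) := by
    rw [← mul_sum]
    have h1 : ∑ x, (v x ⬝ᵥ A x *ᵥ v x) ^ (2 * k)
        ≤ N ^ (2 * k) * ∑ x, (A x ^ (2 * k)).trace := by
      rw [mul_sum]
      refine Finset.sum_le_sum fun x _ => ?_
      rw [← hvv x]
      exact dotProduct_mulVec_pow_le (hAsymm x) (v x) hk
    have h2 := sum_trace_pow_le B (T := 2 * m) (r := 2 * k)
      (fun i a => sum_abs_matchingMatrix_row_le (hM i) (hdisj i) (hσ i) a)
      (fun i => (sum_abs_matchingMatrix (hM i) (hσ i)).le.trans_eq (by rw [hcard])) (by omega)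
    have h3 := sum_rademacher_pow_le (n := n) k
    rw [inv_mul_le_iff₀ (by positivity)]
    calc _ ≤ (N : ℝ) ^ (2 * k) * (2 * m * (2 ^ n * (k * n) ^ k)) := by
          refine h1.trans (mul_le_mul_of_nonneg_left (h2.trans ?_) (by positivity))
          exact mul_le_mul_of_nonneg_left h3 (by positivity)
      _ = _ := by ring
  have hn' : (0 : ℝ) < n := by exact_mod_cast hn
  have hN' : (0 : ℝ) < N := by exact_mod_cast hN
  have hmain : (2 * n * m * η) ^ (2 * k) ≤ N ^ (2 * k) * (2 * m * (k * n) ^ k) :=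
    (pow_le_pow_left₀ (by positivity) hlower _).trans (hjensen.trans hupper)
  refine le_of_mul_le_mul_left ?_ (by positivity : (0 : ℝ) < N ^ (2 * k) * n ^ k)
  calc _ = (2 * n * m * η) ^ (2 * k) := by
        rw [pow_mul, pow_mul, ← mul_pow, ← mul_pow]
        congr 1
        field_simp
    _ ≤ _ := hmain
    _ = _ := by rw [mul_pow]; ring

lemma le_sub_one_mul_rpow_of_forall_pow_le {X T q : ℝ} (hX : 0 ≤ X) (hT : 1 ≤ T) (hq : 2 ≤ q)
    (h : ∀ k : ℕ, 1 ≤ k → X ^ k ≤ (k : ℝ) ^ k * T) : X ≤ (q - 1) * T ^ (2 / q) := by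
  have hT0 : 0 < T := by linarith
  rcases le_total 4 q with hq4 | hq4
  · set K := ⌊q / 2⌋₊ + 1 with hK
    have hK1 : q / 2 < K := by exact_mod_cast Nat.lt_floor_add_one (q / 2)
    have hK2 : (K : ℝ) ≤ q - 1 := by
      have := Nat.floor_le (by linarith : 0 ≤ q / 2)
      push_cast [hK]
      linarith
    have hK0 : (0 : ℝ) < K := by linarith
    have hXK : X ≤ K * T ^ (1 / K : ℝ) := by
      refine le_of_pow_le_pow_left₀ (n := K) (by omega) (by positivity) ?_
      rw [mul_pow, ← Real.rpow_mul_natCast hT0.le, one_div_mul_cancel hK0.ne', Real.rpow_one]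
      exact h K (by omega)
    refine hXK.trans (mul_le_mul hK2 (Real.rpow_le_rpow_of_exponent_le hT ?_) (by positivity)
      (by linarith))
    rw [div_le_div_iff₀ hK0 (by linarith)]
    linarith
  · set s := 1 - 2 / q with hs
    have hs0 : 0 ≤ s := by
      rw [hs, sub_nonneg, div_le_one (by linarith)]
      exact hq
    have hs1 : 2 * s ≤ 1 := by
      have : 1 / 2 ≤ 2 / q := by
        rw [div_le_div_iff₀ (by norm_num) (by linarith)]
        linarith
      linarith
    have h1 : X ≤ T := by simpa using h 1 le_rfl
    have h2 : X ≤ 2 * T ^ (1 / 2 : ℝ) := by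
      refine le_of_pow_le_pow_left₀ (n := 2) (by omega) (by positivity) ?_
      rw [mul_pow, ← Real.rpow_mul_natCast hT0.le]
      simpa using h 2 (by omega)
    have h3 : X ≤ T ^ (1 - 2 * s) * (2 * T ^ (1 / 2 : ℝ)) ^ (2 * s) := by
      calc X = X ^ (1 - 2 * s) * X ^ (2 * s) := by
            rw [← Real.rpow_add_of_nonneg hX (by linarith) (by linarith)]
            simp
        _ ≤ _ := by gcongr
    have h4 : (2 : ℝ) ^ (2 * s) ≤ 1 + 2 * s := by
      have := rpow_one_add_le_one_add_mul_self (by norm_num : (-1 : ℝ) ≤ 1)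
        (by linarith : 0 ≤ 2 * s) hs1
      norm_num at this
      linarith
    have h5 : 1 + 2 * s ≤ q - 1 := by
      have : 2 - 4 / q + 2 ≤ q := by
        have e : q - (2 - 4 / q + 2) = (q - 2) ^ 2 / q := by
          field_simp
          ring
        have : 0 ≤ (q - 2) ^ 2 / q := by positivity
        linarith
      have e : 4 / q = 2 * (2 / q) := by ring
      linarith
    have h6 : T ^ (1 - 2 * s) * (2 * T ^ (1 / 2 : ℝ)) ^ (2 * s) = 2 ^ (2 * s) * T ^ (2 / q) := by
      rw [Real.mul_rpow (by norm_num) (by positivity), ← Real.rpow_mul hT0.le, mul_left_comm,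
        ← Real.rpow_add hT0]
      congr 2
      rw [hs]
      ring
    rw [h6] at h3
    exact h3.trans (mul_le_mul_of_nonneg_right (h4.trans h5) (by positivity))

/-- Key inequality in the 2-query LDC lower bound: if for every `i ∈ [n]` there is a
matching `M_i` of at least `δεN/4` disjoint pairs `{j,k} ⊆ [N]` whose parities
`C(x)_j C(x)_k` predict `x_i` with bias at least `ε/4` (up to a sign `a_{i,Q}`), then
for every `1 < p ≤ 2` we have `n(p-1)(δε/2)^{2/p}(ε/4)² ≤ N^{2(p-1)/p}`. -/
theorem two_query_ldc_key_inequality (n N : ℕ) (hn : 1 ≤ n) (hN : 1 ≤ N)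
    (δ ε : ℝ) (hδ0 : 0 < δ) (hδ1 : δ ≤ 1) (hε0 : 0 < ε) (hε1 : ε ≤ 1)
    (C : (Fin n → Bool) → (Fin N → Bool))
    (H : ∀ i : Fin n, ∃ M : Finset (Finset (Fin N)),
      (∀ Q ∈ M, Q.card = 2) ∧
      (∀ Q ∈ M, ∀ Q' ∈ M, Q ≠ Q' → Disjoint Q Q') ∧
      (M.card : ℝ) ≥ δ * ε * N / 4 ∧
      (∀ Q ∈ M, ∃ a : ℝ, (a = 1 ∨ a = -1) ∧
        (2 ^ n : ℝ)⁻¹ * ∑ x : Fin n → Bool,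
            a * pmOne (x i) * ∏ j ∈ Q, pmOne (C x j) ≥ ε / 4))
    (p : ℝ) (hp1 : 1 < p) (hp2 : p ≤ 2) :
    (n : ℝ) * (p - 1) * (δ * ε / 2) ^ (2 / p) * (ε / 4) ^ 2
      ≤ (N : ℝ) ^ (2 * (p - 1) / p) := by
  have hn' : (0 : ℝ) < n := by exact_mod_cast hn
  have hN' : (0 : ℝ) < N := by exact_mod_cast hN
  have hp0 : 0 < p := by linarith
  have hpm : 0 < p - 1 := by linarith
  choose M₀ hM₀ hdisj₀ hcard₀ hbias₀ using H
  set m := ⌈δ * ε * N / 4⌉₊ with hm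
  have hm1 : 1 ≤ m := Nat.ceil_pos.2 (by positivity)
  have hsub (i : Fin n) : ∃ M ⊆ M₀ i, #M = m :=
    Finset.exists_subset_card_eq (Nat.ceil_le.2 (hcard₀ i))
  choose M hMsub hMcard using hsub
  have hsign (i : Fin n) (Q : Finset (Fin N)) : ∃ a : ℝ, Q ∈ M i → |a| = 1 ∧
      ε / 4 ≤ (2 ^ n : ℝ)⁻¹ *
        ∑ x : Fin n → Bool, a * pmOne (x i) * ∏ j ∈ Q, pmOne (C x j) := by
    by_cases hQ : Q ∈ M i
    · obtain ⟨a, ha, hb⟩ := hbias₀ i Q (hMsub i hQ)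
      exact ⟨a, fun _ => ⟨by rcases ha with rfl | rfl <;> simp, hb⟩⟩
    · exact ⟨0, fun h => absurd h hQ⟩
  choose σ hσ using hsign
  set T : ℝ := 2 * m with hT
  have hmR : (1 : ℝ) ≤ m := by exact_mod_cast hm1
  have hT0 : 0 < T := by linarith
  have hDT : δ * ε / 2 ≤ T / N := by
    rw [le_div_iff₀ hN']
    have := Nat.le_ceil (δ * ε * N / 4)
    linarith
  have hX := le_sub_one_mul_rpow_of_forall_pow_le (X := n * (ε / 4) ^ 2 * (T / N) ^ 2) (T := T)
    (q := p / (p - 1)) (by positivity) (by linarith) (by rw [le_div_iff₀ hpm]; linarith)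
    fun k hk => bias_pow_le hm1 hn hN (by positivity) C M σ
      (fun i Q hQ => hM₀ i Q (hMsub i hQ))
      (fun i Q hQ Q' hQ' => hdisj₀ i Q (hMsub i hQ) Q' (hMsub i hQ')) hMcard
      (fun i Q hQ => (hσ i Q hQ).1) (fun i Q hQ => (hσ i Q hQ).2) hk
  have hq : p / (p - 1) - 1 = 1 / (p - 1) := by
    field_simp
    ring
  set e : ℝ := 2 * (p - 1) / p with he
  have hq2 : 2 / (p / (p - 1)) = e := by
    rw [he]
    field_simp
  have hpe : 2 / p = 2 - e := by
    rw [he]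
    field_simp
    ring
  rw [hq, hq2] at hX
  have hTN : 0 < T / N := by positivity
  have hsplit : (T / N) ^ (2 / p) * T ^ e = (T / N) ^ 2 * (N : ℝ) ^ e := by
    rw [hpe, Real.rpow_sub hTN, Real.div_rpow hT0.le hN'.le e, Real.rpow_two]
    have h1 : T ^ e ≠ 0 := by positivity
    have h2 : (N : ℝ) ^ e ≠ 0 := by positivity
    field_simp
  have hmono : (δ * ε / 2) ^ (2 / p) ≤ (T / N) ^ (2 / p) :=
    Real.rpow_le_rpow (by positivity) hDT (by positivity)
  calc (n : ℝ) * (p - 1) * (δ * ε / 2) ^ (2 / p) * (ε / 4) ^ 2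
      ≤ n * (p - 1) * (T / N) ^ (2 / p) * (ε / 4) ^ 2 := by gcongr
    _ ≤ (N : ℝ) ^ e := by
      refine le_of_mul_le_mul_right ?_ (by positivity : 0 < T ^ e)
      calc (n : ℝ) * (p - 1) * (T / N) ^ (2 / p) * (ε / 4) ^ 2 * T ^ e
          = n * (p - 1) * (ε / 4) ^ 2 * ((T / N) ^ (2 / p) * T ^ e) := by ring
        _ = (p - 1) * (n * (ε / 4) ^ 2 * (T / N) ^ 2) * (N : ℝ) ^ e := by rw [hsplit]; ring
        _ ≤ (p - 1) * (1 / (p - 1) * T ^ e) * (N : ℝ) ^ e := by gcongr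
        _ = (N : ℝ) ^ e * T ^ e := by
          field_simp
end

section
/- Let n, q ≥ 1 be integers, let ε > 0, let i ∈ [n], let f : {±1}^q → {±1}, and let g : {±1}^n → {±1}^q. If 2^{-n}·∑_{x ∈ {±1}^n} f(g(x))·x_i ≥ ε, then there exist a subset S ⊆ [q] and a sign a ∈ {±1} such that 2^{-n}·∑_{x ∈ {±1}^n} a · x_i · ∏_{j ∈ S} g(x)_j ≥ ε/2^q. -/
theorem abs_pmOne (b : Bool) : |pmOne b| = 1 := by
  cases b <;> simp [pmOne]

/-- Orthogonality of the parities: the kernel `∑ S, χ_S y * χ_S z` is `2 ^ q` times the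
indicator of `y = z`. -/
theorem sum_prod_pmOne_mul {ι : Type*} [Fintype ι] [DecidableEq ι] (y z : ι → Bool) :
    ∑ S : Finset ι, (∏ j ∈ S, pmOne (y j)) * ∏ j ∈ S, pmOne (z j) =
      if y = z then 2 ^ Fintype.card ι else 0 := by
  simp_rw [← Finset.prod_mul_distrib]
  rw [← Finset.powerset_univ, ← Finset.prod_one_add]
  split_ifs with h
  · subst h
    have hj (j : ι) : 1 + pmOne (y j) * pmOne (y j) = 2 := by
      cases y j <;> norm_num [pmOne]
    simp [hj]
  · obtain ⟨j, hj⟩ := Function.ne_iff.mp h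
    refine Finset.prod_eq_zero (Finset.mem_univ j) ?_
    cases hy : y j <;> cases hz : z j <;> simp_all [pmOne]

/-- The coefficient of the parity on `S` in the Fourier expansion of `F`. -/
noncomputable def parityCoeff {ι : Type*} [Fintype ι] [DecidableEq ι]
    (F : (ι → Bool) → ℝ) (S : Finset ι) : ℝ :=
  (2 ^ Fintype.card ι : ℝ)⁻¹ * ∑ y, F y * ∏ j ∈ S, pmOne (y j)

theorem sum_parityCoeff_mul {ι : Type*} [Fintype ι] [DecidableEq ι]
    (F : (ι → Bool) → ℝ) (z : ι → Bool) :
    ∑ S, parityCoeff F S * ∏ j ∈ S, pmOne (z j) = F z := by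
  simp_rw [parityCoeff, mul_assoc, Finset.sum_mul, ← Finset.mul_sum]
  rw [Finset.sum_comm]
  simp_rw [mul_assoc, ← Finset.mul_sum, sum_prod_pmOne_mul]
  simp [mul_comm (F z)]

theorem abs_parityCoeff_le_one {ι : Type*} [Fintype ι] [DecidableEq ι]
    {F : (ι → Bool) → ℝ} (hF : ∀ y, |F y| ≤ 1) (S : Finset ι) :
    |parityCoeff F S| ≤ 1 := by
  have hsum : |∑ y, F y * ∏ j ∈ S, pmOne (y j)| ≤ 2 ^ Fintype.card ι := by
    refine (Finset.abs_sum_le_sum_abs _ _).trans ?_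
    refine (Finset.sum_le_card_nsmul _ _ 1 fun y _ => ?_).trans (by simp)
    simpa [abs_mul, Finset.abs_prod, abs_pmOne] using hF y
  rw [parityCoeff, abs_mul, abs_of_pos (by positivity : (0 : ℝ) < (2 ^ Fintype.card ι)⁻¹)]
  exact inv_mul_le_one_of_le₀ hsum (by positivity)

/-- If a Boolean function `f` of the `q` bits `g(x)` predicts `x_i` with bias at least
`ε`, then some parity (or negated parity) of the bits of `g(x)` predicts `x_i` with
bias at least `ε/2^q`. -/
theorem exists_correlated_parity (n q : ℕ) (hn : 1 ≤ n) (hq : 1 ≤ q)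
    (ε : ℝ) (hε : 0 < ε) (i : Fin n)
    (f : (Fin q → Bool) → Bool) (g : (Fin n → Bool) → (Fin q → Bool))
    (H : (2 ^ n : ℝ)⁻¹ * ∑ x : Fin n → Bool, pmOne (f (g x)) * pmOne (x i) ≥ ε) :
    ∃ S : Finset (Fin q), ∃ a : ℝ, (a = 1 ∨ a = -1) ∧
      (2 ^ n : ℝ)⁻¹ * ∑ x : Fin n → Bool,
          a * pmOne (x i) * ∏ j ∈ S, pmOne (g x j) ≥ ε / 2 ^ q := by
  set c : Finset (Fin q) → ℝ := fun S =>
    (2 ^ n : ℝ)⁻¹ * ∑ x : Fin n → Bool, pmOne (x i) * ∏ j ∈ S, pmOne (g x j) with hc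
  have expand : (2 ^ n : ℝ)⁻¹ * ∑ x : Fin n → Bool, pmOne (f (g x)) * pmOne (x i) =
      ∑ S, parityCoeff (fun z => pmOne (f z)) S * c S := by
    simp_rw [hc, Finset.mul_sum]
    rw [Finset.sum_comm]
    refine Finset.sum_congr rfl fun x _ => ?_
    rw [← sum_parityCoeff_mul (fun z => pmOne (f z)) (g x), Finset.sum_mul, Finset.mul_sum]
    exact Finset.sum_congr rfl fun S _ => by ring
  obtain ⟨S, -, hS⟩ : ∃ S ∈ Finset.univ, ε / 2 ^ q ≤ |c S| := by
    refine Finset.exists_le_of_sum_le (f := fun _ => ε / 2 ^ q) Finset.univ_nonempty ?_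
    calc ∑ _S : Finset (Fin q), ε / 2 ^ q = ε := by simp [mul_div_cancel₀]
      _ ≤ ∑ S, parityCoeff (fun z => pmOne (f z)) S * c S := expand ▸ H
      _ ≤ ∑ S, |c S| := Finset.sum_le_sum fun S _ => by
        refine (le_abs_self _).trans ?_
        rw [abs_mul]
        exact mul_le_of_le_one_left (abs_nonneg _)
          (abs_parityCoeff_le_one (fun y => (abs_pmOne _).le) S)
  have factor (a : ℝ) : (2 ^ n : ℝ)⁻¹ * ∑ x : Fin n → Bool,
      a * pmOne (x i) * ∏ j ∈ S, pmOne (g x j) = a * c S := by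
    simp_rw [hc, mul_assoc, ← Finset.mul_sum]
    ring
  rcases le_abs.mp hS with h | h
  · exact ⟨S, 1, Or.inl rfl, by rw [factor]; linarith⟩
  · exact ⟨S, -1, Or.inr rfl, by rw [factor]; linarith⟩
end

section
/- Let n, N, q ≥ 1 be integers, let c > 0 and ε > 0 be reals, let i ∈ [n], and let C : {±1}^n → {±1}^N. Suppose p is a probability distribution on the subsets of [N] of size at most q, and for each such subset Q there is a function f_Q : {±1}^N → [-1,1] depending only on the coordinates in Q, such that: (smoothness) for every j ∈ [N], ∑_{Q : j ∈ Q} p(Q) ≤ c/N; and (correctness) for every x ∈ {±1}^n, x_i · ∑_Q p(Q)·f_Q(C(x)) ≥ 2ε. Then there exists a family M of pairwise disjoint subsets of [N], each of size at most q, with |M| ≥ εN/(cq), such that for every Q ∈ M there is a function h_Q : {±1}^N → {±1} depending only on the coordinates in Q with 2^{-n}·∑_{x ∈ {±1}^n} h_Q(C(x))·x_i ≥ ε. -/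
open Finset in
/-- A `[-1, 1]`-valued function of `z` can be rounded to a `±1`-valued one without decreasing its
correlation with a given weight. -/
theorem exists_sign_sum_le {X Z : Type*} [Fintype X] [Fintype Z] [DecidableEq Z]
    (a : X → Z) (w : X → ℝ) (F : Z → ℝ) (hF : ∀ z, |F z| ≤ 1) :
    ∃ s : Z → ℝ, (∀ z, s z = 1 ∨ s z = -1) ∧
      ∑ x, F (a x) * w x ≤ ∑ x, s (a x) * w x := by
  have key (H : Z → ℝ) : ∑ x, H (a x) * w x = ∑ z, H z * ∑ x with a x = z, w x := by
    rw [← sum_fiberwise univ a]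
    refine sum_congr rfl fun z _ => ?_
    rw [mul_sum]
    refine sum_congr rfl fun x hx => ?_
    rw [(mem_filter.mp hx).2]
  refine ⟨fun z => if 0 ≤ ∑ x with a x = z, w x then 1 else -1, fun z => ?_, ?_⟩
  · dsimp only
    split_ifs <;> simp
  · rw [key, key fun z => if 0 ≤ ∑ x with a x = z, w x then 1 else -1]
    refine sum_le_sum fun z _ => ?_
    obtain ⟨h1, h2⟩ := abs_le.mp (hF z)
    split_ifs with h <;> nlinarith

/-- The coordinate functions on the cube have mean zero. -/
theorem sum_pmOne_apply {n : ℕ} (i : Fin n) : ∑ x : Fin n → Bool, pmOne (x i) = 0 := by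
  refine Finset.sum_involution (fun x _ => Function.update x i (!x i)) ?_ ?_ ?_ ?_
  · intro x _
    cases x i <;> simp [pmOne]
  · intro x _ _ h
    have := congrFun h i
    simp at this
  · simp
  · simp

/-- Every family of nonempty finite sets has a pairwise disjoint subfamily whose union meets every
member of the family. -/
theorem exists_maximal_disjoint_subfamily {α : Type*} [DecidableEq α]
    (G : Finset (Finset α)) (hG : ∀ Q ∈ G, Q.Nonempty) :
    ∃ M ⊆ G, (∀ Q ∈ M, ∀ Q' ∈ M, Q ≠ Q' → Disjoint Q Q') ∧
      ∀ Q ∈ G, ∃ j ∈ M.biUnion id, j ∈ Q := by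
  classical
  obtain ⟨M, hM, hmax⟩ := Finset.exists_max_image
    (G.powerset.filter fun M => ∀ Q ∈ M, ∀ Q' ∈ M, Q ≠ Q' → Disjoint Q Q') Finset.card
    ⟨∅, by simp⟩
  obtain ⟨hMG, hdis⟩ := Finset.mem_filter.mp hM
  rw [Finset.mem_powerset] at hMG
  refine ⟨M, hMG, hdis, fun Q hQ => ?_⟩
  by_contra! hcon
  have hdQ : ∀ R ∈ M, Disjoint R Q := fun R hR =>
    Finset.disjoint_left.mpr fun j hj => hcon j (Finset.mem_biUnion.mpr ⟨R, hR, hj⟩)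
  have hQM : Q ∉ M := fun h =>
    (hG Q hQ).ne_empty (Finset.disjoint_self_iff_empty Q |>.mp (hdQ Q h))
  have := hmax (insert Q M) <| by
    refine Finset.mem_filter.mpr
      ⟨Finset.mem_powerset.mpr (Finset.insert_subset hQ hMG), fun R hR R' hR' hne => ?_⟩
    rcases Finset.mem_insert.mp hR with hRQ | hR <;>
      rcases Finset.mem_insert.mp hR' with hRQ' | hR'
    · exact absurd (hRQ.trans hRQ'.symm) hne
    · exact hRQ ▸ (hdQ R' hR').symm
    · exact hRQ' ▸ hdQ R hR
    · exact hdis R hR R' hR' hne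
  rw [Finset.card_insert_of_notMem hQM] at this
  omega

/-- Katz–Trevisan matching lemma: a smooth decoder for bit `i` yields a family of at
least `εN/(cq)` pairwise disjoint query sets `Q` of size at most `q`, each admitting a
`±1`-valued function of the coordinates in `Q` that predicts `x_i` with bias `ε`. -/
theorem smooth_code_matching (n N q : ℕ) (hn : 1 ≤ n) (hN : 1 ≤ N) (hq : 1 ≤ q)
    (c ε : ℝ) (hc : 0 < c) (hε : 0 < ε) (i : Fin n)
    (C : (Fin n → Bool) → (Fin N → Bool))
    (p : Finset (Fin N) → ℝ)
    (hp0 : ∀ Q, 0 ≤ p Q)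
    (hpsupp : ∀ Q : Finset (Fin N), q < Q.card → p Q = 0)
    (hpsum : ∑ Q : Finset (Fin N), p Q = 1)
    (f : Finset (Fin N) → (Fin N → Bool) → ℝ)
    (hfbd : ∀ Q y, -1 ≤ f Q y ∧ f Q y ≤ 1)
    (hfdep : ∀ Q y y', (∀ j ∈ Q, y j = y' j) → f Q y = f Q y')
    (hsmooth : ∀ j : Fin N,
      ∑ Q ∈ Finset.univ.filter (fun Q : Finset (Fin N) => j ∈ Q), p Q ≤ c / N)
    (hcorrect : ∀ x : Fin n → Bool,
      pmOne (x i) * ∑ Q : Finset (Fin N), p Q * f Q (C x) ≥ 2 * ε) :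
    ∃ M : Finset (Finset (Fin N)),
      (∀ Q ∈ M, Q.card ≤ q) ∧
      (∀ Q ∈ M, ∀ Q' ∈ M, Q ≠ Q' → Disjoint Q Q') ∧
      (M.card : ℝ) ≥ ε * N / (c * q) ∧
      (∀ Q ∈ M, ∃ h : (Fin N → Bool) → ℝ,
        (∀ y, h y = 1 ∨ h y = -1) ∧
        (∀ y y', (∀ j ∈ Q, y j = y' j) → h y = h y') ∧
        (2 ^ n : ℝ)⁻¹ * ∑ x : Fin n → Bool, h (C x) * pmOne (x i) ≥ ε) := by
  classical
  have hpm (b : Bool) : |pmOne b| = 1 := by cases b <;> simp [pmOne]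
  have hfabs (Q y) : |f Q y| ≤ 1 := abs_le.mpr (hfbd Q y)
  have h2n : (0 : ℝ) < 2 ^ n := by positivity
  set A : Finset (Fin N) → ℝ := fun Q =>
    (2 ^ n : ℝ)⁻¹ * ∑ x : Fin n → Bool, f Q (C x) * pmOne (x i) with hA
  have hA1 (Q) : A Q ≤ 1 := by
    have : ∑ x : Fin n → Bool, f Q (C x) * pmOne (x i) ≤ 2 ^ n := by
      calc _ ≤ ∑ x : Fin n → Bool, (1 : ℝ) := by
            refine Finset.sum_le_sum fun x _ => (le_abs_self _).trans ?_
            rw [abs_mul, hpm, mul_one]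
            exact hfabs Q _
        _ = 2 ^ n := by simp
    rw [hA]
    dsimp only
    rw [inv_mul_le_iff₀ h2n]
    simpa using this
  have hAempty : A ∅ = 0 := by
    have : ∑ x : Fin n → Bool, f ∅ (C x) * pmOne (x i)
        = f ∅ (fun _ => true) * ∑ x : Fin n → Bool, pmOne (x i) := by
      rw [Finset.mul_sum]
      refine Finset.sum_congr rfl fun x _ => ?_
      rw [hfdep ∅ (C x) (fun _ => true) (by simp)]
    simp [hA, this, sum_pmOne_apply]
  have hAsum : 2 * ε ≤ ∑ Q, p Q * A Q := by
    have h1 : ∑ Q, p Q * A Q = (2 ^ n : ℝ)⁻¹ *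
        ∑ x : Fin n → Bool, pmOne (x i) * ∑ Q : Finset (Fin N), p Q * f Q (C x) := by
      simp only [hA, Finset.mul_sum]
      rw [Finset.sum_comm]
      refine Finset.sum_congr rfl fun x _ => Finset.sum_congr rfl fun Q _ => ?_
      ring
    rw [h1, le_inv_mul_iff₀ h2n]
    calc (2 ^ n : ℝ) * (2 * ε) = ∑ x : Fin n → Bool, 2 * ε := by simp
      _ ≤ _ := Finset.sum_le_sum fun x _ => hcorrect x
  set G : Finset (Finset (Fin N)) := Finset.univ.filter fun Q => Q.card ≤ q ∧ ε ≤ A Q with hGdef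
  have hG : ε ≤ ∑ Q ∈ G, p Q := by
    have h1 : ∑ Q, p Q * A Q ≤ ∑ Q, ((if Q ∈ G then p Q else 0) + ε * p Q) := by
      refine Finset.sum_le_sum fun Q _ => ?_
      have h0 := hp0 Q
      split_ifs with h
      · nlinarith [hA1 Q, mul_nonneg hε.le h0]
      · rcases lt_or_ge q Q.card with hq' | hq'
        · simp [hpsupp Q hq']
        · have : A Q < ε := by
            by_contra! hc'
            exact h (by simp [hGdef, hq', hc'])
          nlinarith
    rw [Finset.sum_add_distrib, ← Finset.mul_sum, hpsum, Finset.sum_ite_mem,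
      Finset.univ_inter] at h1
    linarith
  obtain ⟨M, hMG, hdis, hmeet⟩ := exists_maximal_disjoint_subfamily G fun Q hQ => by
    rw [Finset.nonempty_iff_ne_empty]
    rintro rfl
    have := (Finset.mem_filter.mp hQ).2.2
    linarith
  have hMq (Q) (hQ : Q ∈ M) : Q.card ≤ q := (Finset.mem_filter.mp (hMG hQ)).2.1
  refine ⟨M, hMq, hdis, ?_, fun Q hQ => ?_⟩
  · have hNpos : (0 : ℝ) < N := by exact_mod_cast hN
    have hqpos : (0 : ℝ) < q := by exact_mod_cast hq
    have h1 : ∑ Q ∈ G, p Q ≤ ∑ j ∈ M.biUnion id,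
        ∑ Q ∈ Finset.univ.filter (fun Q : Finset (Fin N) => j ∈ Q), p Q := by
      simp only [Finset.sum_filter]
      rw [Finset.sum_comm]
      have hnn (Q j) : 0 ≤ if j ∈ Q then p Q else 0 := by
        split_ifs
        exacts [hp0 Q, le_rfl]
      refine (Finset.sum_le_sum fun Q hQ => ?_).trans (Finset.sum_le_sum_of_subset_of_nonneg
        (Finset.subset_univ G) fun Q _ _ => Finset.sum_nonneg fun j _ => hnn Q j)
      obtain ⟨j, hj, hjQ⟩ := hmeet Q hQ
      simpa [hjQ] using Finset.single_le_sum (fun j _ => hnn Q j) hj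
    have h2 := h1.trans (Finset.sum_le_card_nsmul _ _ _ fun j _ => hsmooth j)
    have h3 : ((M.biUnion id).card : ℝ) ≤ M.card * q := by
      exact_mod_cast Finset.card_biUnion_le_card_mul M id q hMq
    rw [nsmul_eq_mul] at h2
    have h4 : ε ≤ M.card * q * (c / N) :=
      (hG.trans h2).trans (mul_le_mul_of_nonneg_right h3 (by positivity))
    rw [ge_iff_le, div_le_iff₀ (by positivity)]
    calc ε * N ≤ M.card * q * (c / N) * N := mul_le_mul_of_nonneg_right h4 hNpos.le
      _ = M.card * (c * q) := by field_simp
  · obtain ⟨s, hs, hle⟩ := exists_sign_sum_le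
      (fun (x : Fin n → Bool) (j : Q) => C x j) (fun x => pmOne (x i))
      (fun z => f Q fun j => if h : j ∈ Q then z ⟨j, h⟩ else true) fun z => hfabs Q _
    refine ⟨fun y => s fun j => y j, fun y => hs _, fun y y' h => ?_, ?_⟩
    · exact congrArg s (funext fun j => h j j.2)
    · have hAQ : ε ≤ A Q := (Finset.mem_filter.mp (hMG hQ)).2.2
      refine hAQ.trans (mul_le_mul_of_nonneg_left (le_trans (le_of_eq ?_) hle) (by positivity))
      refine Finset.sum_congr rfl fun x _ => ?_
      rw [hfdep Q (C x) (fun j => if h : j ∈ Q then C x j else true) fun j hj => by simp [hj]]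
end

section
/- Let n, N, q ≥ 1 be integers, let δ ∈ (0,1] and ε > 0 be reals, let i ∈ [n], and let C : {±1}^n → {±1}^N. Suppose p is a probability distribution on the subsets of [N] of size at most q, and for each such subset Q there is a function f_Q : {±1}^N → [-1,1] depending only on the coordinates in Q, such that for every x ∈ {±1}^n and every y ∈ {±1}^N with |{j ∈ [N] : y_j ≠ C(x)_j}| ≤ δN, one has x_i · ∑_Q p(Q)·f_Q(y) ≥ 2ε. Then there exist a probability distribution p' on the subsets of [N] of size at most q and, for each such subset Q, a function g_Q : {±1}^N → [-1,1] depending only on the coordinates in Q, such that: (smoothness) for every j ∈ [N], ∑_{Q : j ∈ Q} p'(Q) ≤ q/(δN); and (correctness) for every x ∈ {±1}^n, x_i · ∑_Q p'(Q)·g_Q(C(x)) ≥ 2ε. -/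
open Finset in
/-- Markov-type count: if a weight `p` of total mass one on finsets is supported on those of size at
most `q`, then at most `t` points are covered with weight more than `q / t`. -/
theorem card_heavy_le {α : Type*} [Fintype α] [DecidableEq α] (p : Finset α → ℝ) (q : ℕ)
    (hp0 : ∀ Q, 0 ≤ p Q) (hpsupp : ∀ Q : Finset α, q < #Q → p Q = 0) (hpsum : ∑ Q, p Q = 1)
    (hq : 1 ≤ q) {t : ℝ} (ht : 0 < t) :
    (#{j : α | q / t < ∑ Q with j ∈ Q, p Q} : ℝ) ≤ t := by
  set B : Finset α := {j : α | q / t < ∑ Q with j ∈ Q, p Q}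
  have hlower : #B * (q / t) ≤ ∑ j ∈ B, ∑ Q with j ∈ Q, p Q := by
    rw [← nsmul_eq_mul]
    exact card_nsmul_le_sum _ _ _ fun j hj => (mem_filter.mp hj).2.le
  have hupper : ∑ j ∈ B, ∑ Q with j ∈ Q, p Q ≤ q := by
    calc ∑ j ∈ B, ∑ Q with j ∈ Q, p Q
        ≤ ∑ j, ∑ Q with j ∈ Q, p Q :=
          sum_le_univ_sum_of_nonneg fun j => sum_nonneg fun Q _ => hp0 Q
      _ = ∑ Q : Finset α, #Q * p Q := by
          simp_rw [sum_filter]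
          rw [sum_comm]
          simp
      _ ≤ ∑ Q : Finset α, q * p Q := by
          refine sum_le_sum fun Q _ => ?_
          rcases lt_or_ge q #Q with h | h
          · simp [hpsupp Q h]
          · exact mul_le_mul_of_nonneg_right (by exact_mod_cast h) (hp0 Q)
      _ = q := by rw [← mul_sum, hpsum, mul_one]
  have hq' : (0 : ℝ) < q := by exact_mod_cast hq
  have h := hlower.trans hupper
  rw [← mul_div_assoc, div_le_iff₀ ht, mul_comm] at h
  exact le_of_mul_le_mul_left h hq'

/-- Katz–Trevisan: a locally decodable decoder for bit `i` (succeeding with advantage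
`2ε` on every string `y` within Hamming distance `δN` of the codeword `C(x)`) can be
converted into a smooth decoder, i.e. one whose query distribution puts weight at most
`q/(δN)` on every index `j`, while still achieving advantage `2ε` on codewords. -/
theorem ldc_to_smooth_code (n N q : ℕ) (hn : 1 ≤ n) (hN : 1 ≤ N) (hq : 1 ≤ q)
    (δ ε : ℝ) (hδ0 : 0 < δ) (hδ1 : δ ≤ 1) (hε : 0 < ε) (i : Fin n)
    (C : (Fin n → Bool) → (Fin N → Bool))
    (p : Finset (Fin N) → ℝ)
    (hp0 : ∀ Q, 0 ≤ p Q)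
    (hpsupp : ∀ Q : Finset (Fin N), q < Q.card → p Q = 0)
    (hpsum : ∑ Q : Finset (Fin N), p Q = 1)
    (f : Finset (Fin N) → (Fin N → Bool) → ℝ)
    (hfbd : ∀ Q y, -1 ≤ f Q y ∧ f Q y ≤ 1)
    (hfdep : ∀ Q y y', (∀ j ∈ Q, y j = y' j) → f Q y = f Q y')
    (hcorrect : ∀ (x : Fin n → Bool) (y : Fin N → Bool),
      ((Finset.univ.filter (fun j : Fin N => y j ≠ C x j)).card : ℝ) ≤ δ * N →
      pmOne (x i) * ∑ Q : Finset (Fin N), p Q * f Q y ≥ 2 * ε) :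
    ∃ p' : Finset (Fin N) → ℝ,
      (∀ Q, 0 ≤ p' Q) ∧
      (∀ Q : Finset (Fin N), q < Q.card → p' Q = 0) ∧
      (∑ Q : Finset (Fin N), p' Q = 1) ∧
      ∃ g : Finset (Fin N) → (Fin N → Bool) → ℝ,
        (∀ Q y, -1 ≤ g Q y ∧ g Q y ≤ 1) ∧
        (∀ Q y y', (∀ j ∈ Q, y j = y' j) → g Q y = g Q y') ∧
        (∀ j : Fin N,
          ∑ Q ∈ Finset.univ.filter (fun Q : Finset (Fin N) => j ∈ Q), p' Q
            ≤ q / (δ * N)) ∧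
        (∀ x : Fin n → Bool,
          pmOne (x i) * ∑ Q : Finset (Fin N), p' Q * g Q (C x) ≥ 2 * ε) := by
  classical
  have hN' : (0 : ℝ) < N := by exact_mod_cast hN
  have ht : 0 < δ * N := mul_pos hδ0 hN'
  set B : Finset (Fin N) :=
    {j : Fin N | q / (δ * N) < ∑ Q with j ∈ Q, p Q}
  have hBcard : (B.card : ℝ) ≤ δ * N := card_heavy_le p q hp0 hpsupp hpsum hq ht
  let z (y : Fin N → Bool) : Fin N → Bool := fun j => if j ∈ B then true else y j
  let p' (R : Finset (Fin N)) : ℝ := ∑ Q with Q \ B = R, p Q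
  let s (R : Finset (Fin N)) (y : Fin N → Bool) : ℝ := ∑ Q with Q \ B = R, p Q * f Q (z y)
  have hp'0 (R) : 0 ≤ p' R := Finset.sum_nonneg fun Q _ => hp0 Q
  have hs (R y) : |s R y| ≤ p' R :=
    (Finset.abs_sum_le_sum_abs _ _).trans <| Finset.sum_le_sum fun Q _ => by
      rw [abs_mul, abs_of_nonneg (hp0 Q)]
      exact mul_le_of_le_one_right (hp0 Q) (abs_le.mpr (hfbd Q _))
  have hmul (R y) : p' R * (s R y / p' R) = s R y :=
    mul_div_cancel_of_imp' fun h => abs_nonpos_iff.mp (h ▸ hs R y)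
  refine ⟨p', hp'0, fun R hR => Finset.sum_eq_zero fun Q hQ => hpsupp Q ?_, ?_,
    fun R y => s R y / p' R, fun R y => abs_le.mp ?_, fun R y y' hy => ?_, fun j => ?_, fun x => ?_⟩
  · rw [← (Finset.mem_filter.mp hQ).2] at hR
    exact hR.trans_le (Finset.card_le_card Finset.sdiff_subset)
  · rw [← hpsum]
    exact Finset.sum_fiberwise _ _ _
  · rw [abs_div, abs_of_nonneg (hp'0 R)]
    exact div_le_one_of_le₀ (hs R y) (hp'0 R)
  · have hsy : s R y = s R y' := by
      refine Finset.sum_congr rfl fun Q hQ => ?_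
      rw [hfdep Q (z y) (z y') fun j hj => ?_]
      by_cases hjB : j ∈ B
      · simp [z, hjB]
      · have hjR : j ∈ R := by
          rw [← (Finset.mem_filter.mp hQ).2]
          exact Finset.mem_sdiff.mpr ⟨hj, hjB⟩
        simp [z, hjB, hy j hjR]
    simp only [hsy]
  · have hcover : ∑ R with j ∈ R, p' R = ∑ Q with j ∈ Q \ B, p Q := by
      refine .trans ?_ (Finset.sum_fiberwise_of_maps_to (t := {R : Finset (Fin N) | j ∈ R})
        (g := fun Q => Q \ B) (by simp) p)
      refine Finset.sum_congr rfl fun R hR => Finset.sum_congr ?_ fun _ _ => rfl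
      rw [Finset.filter_filter]
      refine Finset.filter_congr fun Q _ => ⟨fun h => ⟨?_, h⟩, And.right⟩
      exact h ▸ (Finset.mem_filter.mp hR).2
    rw [hcover]
    by_cases hjB : j ∈ B
    · simpa [hjB] using by positivity
    · simpa [hjB] using not_lt.mp fun h => hjB (Finset.mem_filter.mpr ⟨Finset.mem_univ j, h⟩)
  · simp only [hmul]
    have hfiber : ∑ R, s R (C x) = ∑ Q, p Q * f Q (z (C x)) := Finset.sum_fiberwise _ _ _
    rw [hfiber]
    refine hcorrect x _ (le_trans ?_ hBcard)
    refine Nat.cast_le.mpr (Finset.card_le_card fun j hj => ?_)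
    by_contra hjB
    simp [z, hjB] at hj
end
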